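/- arXiv:1605.05441 — 2 statements merged into one kernel-verified Lean document; each statement's English description precedes it below -/
import Mathlib

section
/- Suppose there exist constants c, C > 0 and κ ≥ 0 such that the eigenvalues λ_i² of A satisfy c i^κ ≤ λ_i ≤ C i^κ for i = 1,…,d, that φ_d satisfies Assumption 1, and that r = max{s, s', s''} satisfies Assumption 2. If h = l² d^{−1/3−2κ} for some l > 0, then the SLA Metropolis–Hastings algorithm, in equilibrium (x ~ π_d), satisfies E[α(x,y)] → 2Φ(−l³√τ/8) as d → ∞, and for q_i a normalized eigenvector of A, E[(q_i^T(x' − x))²] = 2hΦ(−l³√τ/8) + o(h) as d → ∞, where τ = lim_{d→∞} d^{−1−6κ} Σ_{i=1}^d λ_i^6. -/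
open MeasureTheory ProbabilityTheory Matrix Filter Asymptotics
open scoped Topology

noncomputable section SLASetup

/-- The standard Gaussian measure `N(0, I)` on `ℝ^d`. -/
def stdGaussian (d : ℕ) : Measure (Fin d → ℝ) := Measure.pi fun _ => gaussianReal 0 1

/-- Product measure carrying the two independent standard Gaussian inputs. -/
def prodGaussian (d : ℕ) : Measure ((Fin d → ℝ) × (Fin d → ℝ)) :=
  (stdGaussian d).prod (stdGaussian d)

/-- Standard normal cumulative distribution function `Φ`. -/
def Phi (x : ℝ) : ℝ := (gaussianReal 0 1 (Set.Iic x)).toReal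

/-- Fractional power `A^s = Q diag(λ_i^{2s}) Qᵀ`. -/
def Apow {d : ℕ} (Q : Matrix (Fin d) (Fin d) ℝ) (lam : Fin d → ℝ) (s : ℝ) :
    Matrix (Fin d) (Fin d) ℝ :=
  Q * Matrix.diagonal (fun i => lam i ^ (2 * s)) * Qᵀ

/-- The norm `|v|_s = |A^s v|` (Euclidean norm). -/
def snorm {d : ℕ} (Q : Matrix (Fin d) (Fin d) ℝ) (lam : Fin d → ℝ) (s : ℝ)
    (v : Fin d → ℝ) : ℝ :=
  Real.sqrt ((Apow Q lam s).mulVec v ⬝ᵥ (Apow Q lam s).mulVec v)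

/-- The equilibrium reference state `x = A⁻¹b + Rξ` with `R Rᵀ = A⁻¹`, so that
`x ~ π̃_d` and `e^{-φ_d}` reweights to `π_d`. -/
def xeq {d : ℕ} (A : Matrix (Fin d) (Fin d) ℝ) (b : Fin d → ℝ)
    (R : Matrix (Fin d) (Fin d) ℝ) (ξ : Fin d → ℝ) : Fin d → ℝ :=
  A⁻¹.mulVec b + R.mulVec ξ

/-- The SLA proposal `y = (I - (h/2)A)x + (h/2)b + √h η` with `η ~ N(0, I)`. -/
def ySLA {d : ℕ} (A : Matrix (Fin d) (Fin d) ℝ) (b : Fin d → ℝ) (h : ℝ)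
    (x η : Fin d → ℝ) : Fin d → ℝ :=
  (1 - (h / 2) • A).mulVec x + (h / 2) • b + Real.sqrt h • η

/-- The Gaussian-target log acceptance ratio
`Z = log (π̃(y)q(y,x)) - log (π̃(x)q(x,y))` of the SLA proposal, with
`π̃(z) ∝ exp(-½zᵀAz + bᵀz)` and `q(x,y) ∝ exp(-|y - (I-(h/2)A)x - (h/2)b|²/(2h))`. -/
def ZSLA {d : ℕ} (A : Matrix (Fin d) (Fin d) ℝ) (b : Fin d → ℝ) (h : ℝ)
    (x y : Fin d → ℝ) : ℝ :=
  (-(1/2) * (y ⬝ᵥ A.mulVec y) + b ⬝ᵥ y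
      - (1 / (2 * h)) * ((x - (1 - (h / 2) • A).mulVec y - (h / 2) • b)
          ⬝ᵥ (x - (1 - (h / 2) • A).mulVec y - (h / 2) • b)))
    - (-(1/2) * (x ⬝ᵥ A.mulVec x) + b ⬝ᵥ x
      - (1 / (2 * h)) * ((y - (1 - (h / 2) • A).mulVec x - (h / 2) • b)
          ⬝ᵥ (y - (1 - (h / 2) • A).mulVec x - (h / 2) • b)))

end SLASetup


section GaussianVectors

variable {d : ℕ}

instance : IsProbabilityMeasure (_root_.stdGaussian d) := by
  unfold _root_.stdGaussian; infer_instance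

instance : IsProbabilityMeasure (prodGaussian d) := by
  unfold prodGaussian; infer_instance

lemma measurePreserving_eval_stdGaussian (i : Fin d) :
    MeasurePreserving (fun ξ : Fin d → ℝ => ξ i) (_root_.stdGaussian d) (gaussianReal 0 1) :=
  measurePreserving_eval _ i

lemma memLp_eval_stdGaussian (i : Fin d) :
    MemLp (fun ξ : Fin d → ℝ => ξ i) 2 (_root_.stdGaussian d) :=
  (memLp_id_gaussianReal' 2 (by simp)).comp_measurePreserving
    (measurePreserving_eval_stdGaussian i)

lemma iIndepFun_eval_stdGaussian :
    iIndepFun (fun (i : Fin d) (ξ : Fin d → ℝ) => ξ i) (_root_.stdGaussian d) :=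
  iIndepFun_pi (X := fun _ => id) fun _ => aemeasurable_id

lemma hasGaussianLaw_id_stdGaussian :
    HasGaussianLaw (fun ξ : Fin d → ℝ => ξ) (_root_.stdGaussian d) :=
  iIndepFun_eval_stdGaussian.hasGaussianLaw fun i =>
    ⟨by rw [(measurePreserving_eval_stdGaussian i).map_eq]; infer_instance⟩

lemma integral_eval_stdGaussian (i : Fin d) : ∫ ξ, ξ i ∂(_root_.stdGaussian d) = 0 := by
  have h := integral_map (f := fun x : ℝ => x) (measurePreserving_eval_stdGaussian i).aemeasurable
    (by fun_prop)
  rw [(measurePreserving_eval_stdGaussian i).map_eq, integral_id_gaussianReal] at h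
  exact h.symm

lemma covariance_eval_stdGaussian (i j : Fin d) :
    cov[fun ξ : Fin d → ℝ => ξ i, fun ξ => ξ j; _root_.stdGaussian d] = if i = j then 1 else 0 := by
  split_ifs with h
  · subst h
    rw [covariance_self (measurePreserving_eval_stdGaussian i).aemeasurable]
    have := variance_map (X := fun x : ℝ => x) (by fun_prop)
      (measurePreserving_eval_stdGaussian i).aemeasurable
    rw [(measurePreserving_eval_stdGaussian i).map_eq, variance_fun_id_gaussianReal] at this
    simpa [Function.comp_def] using this.symm
  · exact (iIndepFun_eval_stdGaussian.indepFun h).covariance_eq_zero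
      (memLp_eval_stdGaussian i) (memLp_eval_stdGaussian j)

/-- The functional `ξ ↦ a ⬝ᵥ ξ` as a continuous linear map. -/
noncomputable def dotCLM (a : Fin d → ℝ) : (Fin d → ℝ) →L[ℝ] ℝ :=
  ∑ i, a i • ContinuousLinearMap.proj i

lemma dotCLM_apply (a ξ : Fin d → ℝ) : dotCLM a ξ = a ⬝ᵥ ξ := by
  simp [dotCLM, dotProduct]

lemma covariance_dotProduct_stdGaussian (a b : Fin d → ℝ) :
    cov[fun ξ : Fin d → ℝ => a ⬝ᵥ ξ, fun ξ => b ⬝ᵥ ξ; _root_.stdGaussian d] = a ⬝ᵥ b := by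
  simp only [dotProduct]
  rw [covariance_fun_sum_fun_sum (fun i => (memLp_eval_stdGaussian i).const_mul _)
    (fun i => (memLp_eval_stdGaussian i).const_mul _)]
  simp only [covariance_const_mul_left, covariance_const_mul_right, covariance_eval_stdGaussian]
  simp [mul_comm]

lemma integral_dotProduct_stdGaussian (a : Fin d → ℝ) :
    ∫ ξ, a ⬝ᵥ ξ ∂(_root_.stdGaussian d) = 0 := by
  simp only [dotProduct]
  rw [integral_finsetSum _ fun i _ =>
    ((memLp_eval_stdGaussian i).integrable (by norm_num)).const_mul _]
  simp [integral_const_mul, integral_eval_stdGaussian]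

lemma measurable_dotProduct (a : Fin d → ℝ) : Measurable fun ξ : Fin d → ℝ => a ⬝ᵥ ξ := by
  simp only [dotProduct]; fun_prop

/-- A linear functional of a standard Gaussian vector is a centred Gaussian. -/
lemma map_dotProduct_stdGaussian (a : Fin d → ℝ) :
    (_root_.stdGaussian d).map (fun ξ => a ⬝ᵥ ξ) = gaussianReal 0 (a ⬝ᵥ a).toNNReal := by
  have h : HasGaussianLaw (fun ξ => a ⬝ᵥ ξ) (_root_.stdGaussian d) := by
    simpa only [dotCLM_apply] using hasGaussianLaw_id_stdGaussian.map_fun (dotCLM a)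
  rw [h.map_eq_gaussianReal, integral_dotProduct_stdGaussian,
    ← covariance_self (measurable_dotProduct a).aemeasurable, covariance_dotProduct_stdGaussian]

/-- Orthogonal linear functionals of a standard Gaussian vector are independent. -/
lemma indepFun_dotProduct_stdGaussian {a b : Fin d → ℝ} (hab : a ⬝ᵥ b = 0) :
    IndepFun (fun ξ => a ⬝ᵥ ξ) (fun ξ => b ⬝ᵥ ξ) (_root_.stdGaussian d) := by
  refine HasGaussianLaw.indepFun_of_covariance_eq_zero ?_
    (by rw [covariance_dotProduct_stdGaussian, hab])
  simpa only [ContinuousLinearMap.prod_apply, dotCLM_apply] using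
    hasGaussianLaw_id_stdGaussian.map_fun ((dotCLM a).prod (dotCLM b))

/-- The standard Gaussian measure is invariant under orthogonal matrices. -/
lemma measurePreserving_mulVec_stdGaussian {W : Matrix (Fin d) (Fin d) ℝ} (hW : W * Wᵀ = 1) :
    MeasurePreserving W.mulVec (_root_.stdGaussian d) (_root_.stdGaussian d) := by
  have hdot (i j : Fin d) : W i ⬝ᵥ W j = if i = j then 1 else 0 := by
    rw [← Matrix.one_apply, ← hW]; rfl
  have hmeas : Measurable W.mulVec := measurable_pi_lambda _ fun i => measurable_dotProduct (W i)
  have hlaw : HasGaussianLaw (fun ξ : Fin d → ℝ => fun i => W i ⬝ᵥ ξ) (_root_.stdGaussian d) := by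
    have h := hasGaussianLaw_id_stdGaussian.map_fun (ContinuousLinearMap.pi fun i => dotCLM (W i))
    have heq (ξ : Fin d → ℝ) : ContinuousLinearMap.pi (fun i => dotCLM (W i)) ξ =
        fun i => W i ⬝ᵥ ξ := funext fun i => dotCLM_apply (W i) ξ
    simpa only [heq] using h
  have hind := hlaw.iIndepFun_of_covariance_eq_zero (X := fun i ξ => W i ⬝ᵥ ξ) fun i j hij => by
    rw [covariance_dotProduct_stdGaussian, hdot, if_neg hij]
  refine ⟨hmeas, ?_⟩
  have h := (iIndepFun_iff_map_fun_eq_pi_map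
    fun i => (measurable_dotProduct (W i)).aemeasurable).1 hind
  simp only [map_dotProduct_stdGaussian, hdot, if_true, Real.toNNReal_one] at h
  exact h

end GaussianVectors

section GaussianMoments

lemma integrable_pow_gaussianReal (n : ℕ) : Integrable (fun x : ℝ => x ^ n) (gaussianReal 0 1) := by
  have h := (memLp_id_gaussianReal' (μ := 0) (v := 1) (n : ENNReal) (by simp)).integrable_norm_pow'
  exact h.mono' (by fun_prop) (.of_forall fun x => by simp)

lemma integral_sq_gaussianReal : ∫ x, x ^ 2 ∂(gaussianReal 0 1) = 1 := by
  have h := variance_eq_sub (memLp_id_gaussianReal' (μ := 0) (v := 1) 2 (by simp))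
  rw [variance_id_gaussianReal] at h
  simpa using h.symm

lemma integral_abs_gaussianReal_le : ∫ x, |x| ∂(gaussianReal 0 1) ≤ 1 := by
  have h : ∫ x, |x| ∂(gaussianReal 0 1) ≤ ∫ x, (1 + x ^ 2) / 2 ∂(gaussianReal 0 1) := by
    refine integral_mono ?_ ((integrable_const _).add (integrable_pow_gaussianReal 2) |>.div_const _)
      fun x => ?_
    · simpa using (integrable_pow_gaussianReal 1).abs
    · nlinarith [sq_nonneg (|x| - 1), sq_abs x]
  rw [integral_div, integral_add (integrable_const _) (integrable_pow_gaussianReal 2),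
    integral_sq_gaussianReal] at h
  simpa using h

lemma integral_abs_le_sqrt {Ω : Type*} [MeasurableSpace Ω] {μ : Measure Ω} [IsProbabilityMeasure μ]
    {f : Ω → ℝ} (hf : MemLp f 2 μ) : ∫ ω, |f ω| ∂μ ≤ √(∫ ω, f ω ^ 2 ∂μ) := by
  refine Real.le_sqrt_of_sq_le ?_
  have h := variance_nonneg (fun ω => |f ω|) μ
  rw [variance_eq_sub (X := fun ω => |f ω|) hf.abs] at h
  simp only [Pi.pow_apply, sq_abs] at h
  linarith

lemma memLp_sq_sub_one_gaussianReal : MemLp (fun x : ℝ => x ^ 2 - 1) 2 (gaussianReal 0 1) := by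
  rw [memLp_two_iff_integrable_sq (by fun_prop)]
  refine (((integrable_pow_gaussianReal 4).sub ((integrable_pow_gaussianReal 2).const_mul 2)).add
    (integrable_const 1)).congr (.of_forall fun x => ?_)
  simp only [Pi.add_apply, Pi.sub_apply]; ring

variable {d : ℕ}

lemma integrable_comp_eval_stdGaussian {f : ℝ → ℝ} (hf : Integrable f (gaussianReal 0 1))
    (i : Fin d) : Integrable (fun ξ : Fin d → ℝ => f (ξ i)) (_root_.stdGaussian d) :=
  (measurePreserving_eval_stdGaussian i).integrable_comp_of_integrable hf

lemma integral_comp_eval_stdGaussian {f : ℝ → ℝ} (hf : Integrable f (gaussianReal 0 1))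
    (i : Fin d) : ∫ ξ, f (ξ i) ∂(_root_.stdGaussian d) = ∫ x, f x ∂(gaussianReal 0 1) := by
  have hm := measurePreserving_eval_stdGaussian i
  rw [← hm.map_eq, integral_map hm.aemeasurable]
  rw [hm.map_eq]; exact hf.aestronglyMeasurable

lemma integrable_sum_mul_sq (c : Fin d → ℝ) :
    Integrable (fun ξ => ∑ i, c i * ξ i ^ 2) (_root_.stdGaussian d) :=
  integrable_finsetSum _ fun i _ =>
    (integrable_comp_eval_stdGaussian (integrable_pow_gaussianReal 2) i).const_mul _

lemma integral_sum_mul_sq (c : Fin d → ℝ) :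
    ∫ ξ, ∑ i, c i * ξ i ^ 2 ∂(_root_.stdGaussian d) = ∑ i, c i := by
  rw [integral_finsetSum _ fun i _ =>
    (integrable_comp_eval_stdGaussian (integrable_pow_gaussianReal 2) i).const_mul _]
  simp [integral_const_mul, integral_comp_eval_stdGaussian (integrable_pow_gaussianReal 2),
    integral_sq_gaussianReal]

lemma memLp_dotProduct (a : Fin d → ℝ) : MemLp (fun ξ => a ⬝ᵥ ξ) 2 (_root_.stdGaussian d) := by
  simp only [dotProduct]
  exact memLp_finsetSum _ fun i _ => (memLp_eval_stdGaussian i).const_mul _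

lemma integral_dotProduct_sq (a : Fin d → ℝ) :
    ∫ ξ, (a ⬝ᵥ ξ) ^ 2 ∂(_root_.stdGaussian d) = a ⬝ᵥ a := by
  have h := variance_eq_sub (memLp_dotProduct a)
  rw [integral_dotProduct_stdGaussian, ← covariance_self (measurable_dotProduct a).aemeasurable,
    covariance_dotProduct_stdGaussian] at h
  simpa using h.symm

/-- The centred quadratic form `∑ cᵢ (ξᵢ² - 1)`. -/
def chaosSum (c ξ : Fin d → ℝ) : ℝ := ∑ i, c i * (ξ i ^ 2 - 1)

lemma memLp_chaosSum (c : Fin d → ℝ) : MemLp (chaosSum c) 2 (_root_.stdGaussian d) := by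
  refine memLp_finsetSum _ fun i _ => ?_
  exact (memLp_sq_sub_one_gaussianReal.comp_measurePreserving
    (measurePreserving_eval_stdGaussian i)).const_mul (c i)

lemma integral_chaosSum_sq (c : Fin d → ℝ) :
    ∫ ξ, chaosSum c ξ ^ 2 ∂(_root_.stdGaussian d) =
      Var[fun x => x ^ 2 - 1; gaussianReal 0 1] * ∑ i, c i ^ 2 := by
  have hv : Var[chaosSum c; _root_.stdGaussian d] =
      Var[fun x => x ^ 2 - 1; gaussianReal 0 1] * ∑ i, c i ^ 2 := by
    have := variance_sum_pi (μ := fun _ : Fin d => gaussianReal 0 1)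
      (X := fun i x => c i * (x ^ 2 - 1)) fun i => memLp_sq_sub_one_gaussianReal.const_mul (c i)
    simp only [variance_const_mul] at this
    rw [← Finset.sum_mul, mul_comm] at this
    rw [← this]
    congr 1
    ext ξ
    simp [chaosSum]
  have h0 : ∫ ξ, chaosSum c ξ ∂(_root_.stdGaussian d) = 0 := by
    have h := integral_sum_mul_sq c
    have : ∀ ξ : Fin d → ℝ, chaosSum c ξ = (∑ i, c i * ξ i ^ 2) - ∑ i, c i := fun ξ => by
      simp [chaosSum, mul_sub]
    simp only [this]
    rw [integral_sub (integrable_sum_mul_sq c) (integrable_const _), h]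
    simp
  rw [variance_eq_sub (memLp_chaosSum c), h0] at hv
  simpa using hv

/-- `E[1 ∧ e^{σN - σ²/2}] = 2Φ(-σ/2)`. -/
lemma integral_min_one_exp_gaussianReal {σ : ℝ} (hσ : 0 ≤ σ) :
    ∫ x, min 1 (Real.exp (σ * x - σ ^ 2 / 2)) ∂(gaussianReal 0 1) = 2 * Phi (-σ / 2) := by
  have hint : Integrable (fun x => min 1 (Real.exp (σ * x - σ ^ 2 / 2))) (gaussianReal 0 1) := by
    refine (integrable_const (1 : ℝ)).mono' (by fun_prop) (.of_forall fun x => ?_)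
    rw [Real.norm_of_nonneg (by positivity)]
    exact min_le_left _ _
  rw [← integral_add_compl (measurableSet_Iic (a := σ / 2)) hint, two_mul]
  congr 1
  · have h1 : ∫ x in Set.Iic (σ / 2), min 1 (Real.exp (σ * x - σ ^ 2 / 2)) ∂(gaussianReal 0 1) =
        ∫ x in Set.Iic (σ / 2), Real.exp (σ * x - σ ^ 2 / 2) ∂(gaussianReal 0 1) := by
      refine setIntegral_congr_fun measurableSet_Iic fun x hx => min_eq_right ?_
      rw [Real.exp_le_one_iff]
      nlinarith [mul_le_mul_of_nonneg_left (Set.mem_Iic.1 hx) hσ]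
    have h2 : ∫ x in Set.Iic (σ / 2), Real.exp (σ * x - σ ^ 2 / 2) ∂(gaussianReal 0 1) =
        (gaussianReal σ 1).real (Set.Iic (σ / 2)) := by
      rw [← integral_indicator measurableSet_Iic,
        integral_gaussianReal_eq_integral_smul one_ne_zero, measureReal_def,
        gaussianReal_apply_eq_integral _ one_ne_zero, ENNReal.toReal_ofReal
          (integral_nonneg fun x => gaussianPDFReal_nonneg _ _ _),
        ← integral_indicator measurableSet_Iic]
      congr 1 with x
      by_cases hx : x ∈ Set.Iic (σ / 2)
      · simp only [Set.indicator_of_mem hx, gaussianPDFReal, smul_eq_mul, mul_assoc,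
          ← Real.exp_add]
        congr 3
        simp
        ring
      · simp [Set.indicator_of_notMem hx]
    rw [h1, h2, Phi, ← measureReal_def, ← zero_add σ, ← gaussianReal_map_add_const, measureReal_def,
      measureReal_def, Measure.map_apply (by fun_prop) measurableSet_Iic]
    congr 2
    ext x
    simp only [Set.mem_preimage, Set.mem_Iic, zero_add]
    constructor <;> intro h <;> linarith
  · have h1 : ∫ x in (Set.Iic (σ / 2))ᶜ, min 1 (Real.exp (σ * x - σ ^ 2 / 2)) ∂(gaussianReal 0 1) =
        ∫ x in (Set.Iic (σ / 2))ᶜ, (1 : ℝ) ∂(gaussianReal 0 1) := by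
      refine setIntegral_congr_fun measurableSet_Iic.compl fun x hx => min_eq_left ?_
      rw [Real.one_le_exp_iff]
      have hx' : σ / 2 < x := by simpa using hx
      nlinarith [mul_le_mul_of_nonneg_left hx'.le hσ]
    rw [h1, Phi]
    have hneg := gaussianReal_map_neg (μ := 0) (v := 1)
    rw [neg_zero] at hneg
    nth_rw 2 [← hneg]
    rw [Measure.map_apply (by fun_prop) measurableSet_Iic]
    simp only [integral_const, smul_eq_mul, mul_one, measureReal_def,
      Measure.restrict_apply_univ]
    congr 1
    have := nullSingletonClass_gaussianReal (μ := 0) (v := 1) one_ne_zero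
    rw [Set.compl_Iic, measure_congr Ioi_ae_eq_Ici]
    congr 1
    ext x
    simp only [Set.mem_preimage, Set.mem_Iic, Set.mem_Ici]
    constructor <;> intro h <;> linarith

end GaussianMoments

section AcceptanceComparison

/-- The Metropolis acceptance function `t ↦ 1 ∧ eᵗ`. -/
noncomputable def acc (t : ℝ) : ℝ := min 1 (Real.exp t)

lemma acc_nonneg (t : ℝ) : 0 ≤ acc t := le_min zero_le_one (Real.exp_pos t).le

lemma acc_le_one (t : ℝ) : acc t ≤ 1 := min_le_left _ _

lemma measurable_acc : Measurable acc := by unfold acc; fun_prop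

lemma acc_sub_le {s t : ℝ} (hst : s ≤ t) : acc t - acc s ≤ t - s := by
  unfold acc
  rcases le_total s 0 with hs | hs
  · have h1 : Real.exp s ≤ 1 := Real.exp_le_one_iff.2 hs
    rw [min_eq_right h1]
    rcases le_total t 0 with ht | ht
    · have h2 : Real.exp t ≤ 1 := Real.exp_le_one_iff.2 ht
      have h3 : Real.exp s = Real.exp t * Real.exp (s - t) := by rw [← Real.exp_add]; ring_nf
      have h4 := Real.add_one_le_exp (s - t)
      rw [min_eq_right h2]
      nlinarith [Real.exp_pos t]
    · have h4 := Real.add_one_le_exp s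
      linarith [min_le_left 1 (Real.exp t)]
  · rw [min_eq_left (Real.one_le_exp_iff.2 hs)]
    linarith [min_le_left 1 (Real.exp t)]

lemma acc_mono {s t : ℝ} (hst : s ≤ t) : acc s ≤ acc t :=
  min_le_min le_rfl (Real.exp_le_exp.2 hst)

lemma abs_acc_sub_acc_le (s t : ℝ) : |acc s - acc t| ≤ |s - t| := by
  rcases le_total s t with h | h
  · rw [abs_sub_comm, abs_sub_comm s t, abs_of_nonneg (sub_nonneg.2 (acc_mono h)),
      abs_of_nonneg (sub_nonneg.2 h)]
    exact acc_sub_le h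
  · rw [abs_of_nonneg (sub_nonneg.2 (acc_mono h)), abs_of_nonneg (sub_nonneg.2 h)]
    exact acc_sub_le h

lemma abs_acc_sub_acc_le_min (s t : ℝ) : |acc s - acc t| ≤ min 1 |s - t| :=
  le_min (abs_sub_le_iff.2 ⟨by linarith [acc_le_one s, acc_nonneg t],
    by linarith [acc_le_one t, acc_nonneg s]⟩) (abs_acc_sub_acc_le s t)

variable {d : ℕ}

/-- A function of `p ⬝ᵥ η` decouples from a function of `e ⬝ᵥ η` when `p ⊥ e`. -/
lemma integral_dotProduct_mul_dotProduct {p e : Fin d → ℝ} (hp : p ⬝ᵥ p = 1) (hpe : p ⬝ᵥ e = 0)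
    {w f : ℝ → ℝ} (hw : Measurable w) (hf : Measurable f) :
    ∫ η, w (p ⬝ᵥ η) * f (e ⬝ᵥ η) ∂(_root_.stdGaussian d) =
      (∫ x, w x ∂(gaussianReal 0 1)) * ∫ x, f (√(e ⬝ᵥ e) * x) ∂(gaussianReal 0 1) := by
  have hind := (indepFun_dotProduct_stdGaussian hpe).comp hw hf
  have h := hind.integral_mul_eq_mul_integral
    (hw.comp (measurable_dotProduct p)).aestronglyMeasurable
    (hf.comp (measurable_dotProduct e)).aestronglyMeasurable
  have h1 : ∫ η, w (p ⬝ᵥ η) ∂(_root_.stdGaussian d) = ∫ x, w x ∂(gaussianReal 0 1) := by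
    have := map_dotProduct_stdGaussian p
    rw [hp, Real.toNNReal_one] at this
    rw [← this, integral_map (measurable_dotProduct p).aemeasurable hw.aestronglyMeasurable]
  have h2 : ∫ η, f (e ⬝ᵥ η) ∂(_root_.stdGaussian d) =
      ∫ x, f (√(e ⬝ᵥ e) * x) ∂(gaussianReal 0 1) := by
    have h0 : 0 ≤ e ⬝ᵥ e := Finset.sum_nonneg fun i _ => mul_self_nonneg _
    have h3 := map_dotProduct_stdGaussian e
    have h4 := gaussianReal_map_const_mul (μ := 0) (v := 1) (√(e ⬝ᵥ e))
    have h5 : (e ⬝ᵥ e).toNNReal = NNReal.mk (√(e ⬝ᵥ e) ^ 2) (sq_nonneg _) * 1 := by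
      rw [mul_one]; ext; simp [Real.sq_sqrt h0, h0]
    rw [mul_zero, ← h5, ← h3] at h4
    rw [← integral_map (φ := fun η => e ⬝ᵥ η) (measurable_dotProduct e).aemeasurable
      hf.aestronglyMeasurable, ← h4, integral_map (by fun_prop) hf.aestronglyMeasurable]
  rw [← h1, ← h2]
  exact h

lemma abs_sqrt_sub_le {v σ ε : ℝ} (hv : 0 ≤ v) (hσ : 0 ≤ σ) (hε : 0 < ε) :
    |√v - σ| ≤ ε + |v - σ ^ 2| / ε := by
  have h1 : |√v - σ| ^ 2 ≤ |v - σ ^ 2| := by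
    have : v - σ ^ 2 = (√v - σ) * (√v + σ) := by nlinarith [Real.sq_sqrt hv]
    rw [this, abs_mul, sq]
    refine mul_le_mul_of_nonneg_left ?_ (abs_nonneg _)
    rw [abs_of_nonneg (add_nonneg (Real.sqrt_nonneg v) hσ)]
    exact abs_sub_le_iff.2 ⟨by linarith, by linarith [Real.sqrt_nonneg v]⟩
  by_cases h : |√v - σ| ≤ ε
  · have : 0 ≤ |v - σ ^ 2| / ε := by positivity
    linarith
  · have : |√v - σ| ≤ |v - σ ^ 2| / ε := by
      rw [le_div_iff₀ hε]
      nlinarith [abs_nonneg (√v - σ)]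
    linarith

/-- Quantitative comparison of a weighted mean acceptance probability with `2Φ(-σ/2)`, for a
log-ratio `X` close to `e(ζ) ⬝ᵥ η - σ²/2`, a form that is Gaussian given `ζ` and independent of
the weight `w (p ⬝ᵥ η)`. -/
lemma abs_integral_acc_sub_le {p : Fin d → ℝ} (hp : p ⬝ᵥ p = 1) {w : ℝ → ℝ} (hw : Measurable w)
    (hw0 : ∀ x, 0 ≤ w x) (hw1 : ∫ x, w x ∂(gaussianReal 0 1) = 1)
    (hw2 : Integrable (fun x => w x ^ 2) (gaussianReal 0 1))
    {ρ : (Fin d → ℝ) → ℝ} (hρ : Measurable ρ) (hρ0 : ∀ ζ, 0 ≤ ρ ζ) {K : ℝ} (hρK : ∀ ζ, ρ ζ ≤ K)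
    (hρ1 : ∫ ζ, ρ ζ ∂(_root_.stdGaussian d) = 1)
    {X : (Fin d → ℝ) × (Fin d → ℝ) → ℝ} (hX : Measurable X)
    {e : (Fin d → ℝ) → Fin d → ℝ} (he : Measurable e) (hpe : ∀ ζ, p ⬝ᵥ e ζ = 0)
    {σ : ℝ} (hσ : 0 ≤ σ)
    (hv : Integrable (fun ζ => |e ζ ⬝ᵥ e ζ - σ ^ 2|) (_root_.stdGaussian d))
    {ε : ℝ} (hε : 0 < ε) :
    |∫ ω, w (p ⬝ᵥ ω.2) * acc (X ω) * ρ ω.1 ∂(prodGaussian d) - 2 * Phi (-σ / 2)| ≤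
      K * (ε * (∫ x, w x ^ 2 ∂(gaussianReal 0 1)) +
        (∫ ω, min 1 |X ω - (e ω.1 ⬝ᵥ ω.2 - σ ^ 2 / 2)| ∂(prodGaussian d)) / ε) +
      K * (ε + (∫ ζ, |e ζ ⬝ᵥ e ζ - σ ^ 2| ∂(_root_.stdGaussian d)) / ε) := by
  have hK : 0 ≤ K := (hρ0 0).trans (hρK 0)
  set Y : (Fin d → ℝ) × (Fin d → ℝ) → ℝ := fun ω => e ω.1 ⬝ᵥ ω.2 - σ ^ 2 / 2 with hYdef
  have hY : Measurable Y := by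
    simp only [hYdef, dotProduct]
    fun_prop
  have hpm := measurable_dotProduct p
  have hN : Measurable fun ω : (Fin d → ℝ) × (Fin d → ℝ) => w (p ⬝ᵥ ω.2) :=
    hw.comp (hpm.comp measurable_snd)
  have hmapp : (prodGaussian d).map (fun ω => p ⬝ᵥ ω.2) = gaussianReal 0 1 := by
    have h := map_dotProduct_stdGaussian p
    rw [hp, Real.toNNReal_one] at h
    rw [show (fun ω : (Fin d → ℝ) × (Fin d → ℝ) => p ⬝ᵥ ω.2) = (fun η => p ⬝ᵥ η) ∘ Prod.snd from rfl,
      ← Measure.map_map hpm measurable_snd, prodGaussian, Measure.map_snd_prod]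
    simpa using h
  have hmp : MeasurePreserving (fun ω : (Fin d → ℝ) × (Fin d → ℝ) => p ⬝ᵥ ω.2) (prodGaussian d)
    (gaussianReal 0 1) := ⟨hpm.comp measurable_snd, hmapp⟩
  have hw2i : Integrable (fun ω => w (p ⬝ᵥ ω.2) ^ 2) (prodGaussian d) :=
    hmp.integrable_comp_of_integrable hw2
  have hwi : Integrable (fun ω => w (p ⬝ᵥ ω.2)) (prodGaussian d) :=
    ((memLp_two_iff_integrable_sq hN.aestronglyMeasurable).2 hw2i).integrable (by norm_num)
  have hI {T : (Fin d → ℝ) × (Fin d → ℝ) → ℝ} (hT : Measurable T) :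
      Integrable (fun ω => w (p ⬝ᵥ ω.2) * acc (T ω) * ρ ω.1) (prodGaussian d) := by
    refine (hwi.mul_const K).mono'
      ((hN.mul (measurable_acc.comp hT)).mul (hρ.comp measurable_fst)).aestronglyMeasurable
      (.of_forall fun ω => ?_)
    rw [Real.norm_of_nonneg (mul_nonneg (mul_nonneg (hw0 _) (acc_nonneg _)) (hρ0 _))]
    exact mul_le_mul (mul_le_of_le_one_right (hw0 _) (acc_le_one _)) (hρK _) (hρ0 _) (hw0 _)
  have hm : Integrable (fun ω => min 1 |X ω - Y ω|) (prodGaussian d) := by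
    refine (integrable_const (1 : ℝ)).mono'
      (measurable_const.min (hX.sub hY).abs).aestronglyMeasurable (.of_forall fun ω => ?_)
    rw [Real.norm_of_nonneg (by positivity)]
    exact min_le_left _ _
  have hXY : |∫ ω, w (p ⬝ᵥ ω.2) * acc (X ω) * ρ ω.1 ∂(prodGaussian d) -
      ∫ ω, w (p ⬝ᵥ ω.2) * acc (Y ω) * ρ ω.1 ∂(prodGaussian d)| ≤
      K * (ε * (∫ x, w x ^ 2 ∂(gaussianReal 0 1)) +
        (∫ ω, min 1 |X ω - Y ω| ∂(prodGaussian d)) / ε) := by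
    rw [← integral_sub (hI hX) (hI hY), ← hmapp, integral_map hmp.aemeasurable
      (by rw [hmapp]; exact hw2.aestronglyMeasurable), ← integral_const_mul, ← integral_div,
      ← integral_add (hw2i.const_mul ε) (hm.div_const ε), ← integral_const_mul, ← Real.norm_eq_abs]
    refine norm_integral_le_of_norm_le (((hw2i.const_mul ε).add (hm.div_const ε)).const_mul K)
      (.of_forall fun ω => ?_)
    rw [← sub_mul, ← mul_sub, Real.norm_eq_abs, abs_mul, abs_mul, abs_of_nonneg (hw0 _),
      abs_of_nonneg (hρ0 _), mul_comm]
    refine mul_le_mul (hρK _) ?_ (mul_nonneg (hw0 _) (abs_nonneg _)) hK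
    set m := min 1 |X ω - Y ω|
    have hm0 : 0 ≤ m := by positivity
    have hm1 : m ≤ 1 := min_le_left _ _
    refine (mul_le_mul_of_nonneg_left (abs_acc_sub_acc_le_min _ _) (hw0 _)).trans ?_
    change w (p ⬝ᵥ ω.2) * m ≤ _
    have h1 : m / ε = m * ε⁻¹ := rfl
    have h2 : ε * ε⁻¹ = 1 := mul_inv_cancel₀ hε.ne'
    have h3 : 0 < ε⁻¹ := inv_pos.2 hε
    have h4 : w (p ⬝ᵥ ω.2) * m ≤ ε * w (p ⬝ᵥ ω.2) ^ 2 + m ^ 2 * ε⁻¹ := by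
      have h5 : (ε * w (p ⬝ᵥ ω.2) - m) ^ 2 * ε⁻¹ =
          ε * w (p ⬝ᵥ ω.2) ^ 2 - 2 * (w (p ⬝ᵥ ω.2) * m) + m ^ 2 * ε⁻¹ := by
        field_simp
        ring
      have h6 : 0 ≤ (ε * w (p ⬝ᵥ ω.2) - m) ^ 2 * ε⁻¹ := by positivity
      nlinarith [mul_nonneg (hw0 (p ⬝ᵥ ω.2)) hm0]
    have h7 : m ^ 2 * ε⁻¹ ≤ m * ε⁻¹ := by
      refine mul_le_mul_of_nonneg_right ?_ h3.le
      nlinarith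
    rw [h1]
    exact h4.trans (by linarith)
  set g : ℝ → ℝ := fun s => ∫ x, acc (s * x - σ ^ 2 / 2) ∂(gaussianReal 0 1) with hg
  have hacci (s : ℝ) : Integrable (fun x => acc (s * x - σ ^ 2 / 2)) (gaussianReal 0 1) := by
    refine (integrable_const (1 : ℝ)).mono' (measurable_acc.comp (by fun_prop)).aestronglyMeasurable
      (.of_forall fun x => ?_)
    rw [Real.norm_of_nonneg (acc_nonneg _)]
    exact acc_le_one _
  have hglip (s : ℝ) : |g s - g σ| ≤ |s - σ| := by
    rw [hg]
    simp only
    rw [← integral_sub (hacci s) (hacci σ), ← Real.norm_eq_abs]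
    have hxi : Integrable (fun x : ℝ => |s - σ| * |x|) (gaussianReal 0 1) := by
      simpa using (integrable_pow_gaussianReal 1).abs.const_mul |s - σ|
    refine (norm_integral_le_of_norm_le hxi (.of_forall fun x => ?_)).trans ?_
    · refine (abs_acc_sub_acc_le _ _).trans_eq ?_
      rw [← abs_mul]; ring_nf
    · rw [integral_const_mul]
      exact mul_le_of_le_one_right (abs_nonneg _) integral_abs_gaussianReal_le
  have hgσ : g σ = 2 * Phi (-σ / 2) := integral_min_one_exp_gaussianReal hσ
  have hinner (ζ : Fin d → ℝ) : ∫ η, w (p ⬝ᵥ η) * acc (Y (ζ, η)) * ρ ζ ∂(_root_.stdGaussian d) =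
      g (√(e ζ ⬝ᵥ e ζ)) * ρ ζ := by
    rw [integral_mul_const, integral_dotProduct_mul_dotProduct hp (hpe ζ) hw
      (f := fun t => acc (t - σ ^ 2 / 2)) (measurable_acc.comp (by fun_prop)), hw1, one_mul]
  have hJ : ∫ ω, w (p ⬝ᵥ ω.2) * acc (Y ω) * ρ ω.1 ∂(prodGaussian d) =
      ∫ ζ, g (√(e ζ ⬝ᵥ e ζ)) * ρ ζ ∂(_root_.stdGaussian d) := by
    rw [prodGaussian, integral_prod _ (hI hY)]
    exact integral_congr_ae (.of_forall hinner)
  have hgi : Integrable (fun ζ => g (√(e ζ ⬝ᵥ e ζ)) * ρ ζ) (_root_.stdGaussian d) :=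
    (hI hY).integral_prod_left.congr (.of_forall hinner)
  have hρi : Integrable ρ (_root_.stdGaussian d) := by
    refine (integrable_const K).mono' hρ.aestronglyMeasurable (.of_forall fun ζ => ?_)
    rw [Real.norm_of_nonneg (hρ0 _)]
    exact hρK _
  have hYΦ : |∫ ω, w (p ⬝ᵥ ω.2) * acc (Y ω) * ρ ω.1 ∂(prodGaussian d) - 2 * Phi (-σ / 2)| ≤
      K * (ε + (∫ ζ, |e ζ ⬝ᵥ e ζ - σ ^ 2| ∂(_root_.stdGaussian d)) / ε) := by
    have h1 : 2 * Phi (-σ / 2) = ∫ ζ, g σ * ρ ζ ∂(_root_.stdGaussian d) := by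
      rw [integral_const_mul, hρ1, mul_one, hgσ]
    have h2 : ε + (∫ ζ, |e ζ ⬝ᵥ e ζ - σ ^ 2| ∂(_root_.stdGaussian d)) / ε =
        ∫ ζ, (ε + |e ζ ⬝ᵥ e ζ - σ ^ 2| / ε) ∂(_root_.stdGaussian d) := by
      rw [integral_add (integrable_const _) (hv.div_const _), integral_div]
      simp
    rw [hJ, h1, ← integral_sub hgi (hρi.const_mul _), h2, ← integral_const_mul, ← Real.norm_eq_abs]
    refine norm_integral_le_of_norm_le
      (((integrable_const ε).add (hv.div_const ε)).const_mul K) (.of_forall fun ζ => ?_)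
    rw [← sub_mul, Real.norm_eq_abs, abs_mul, abs_of_nonneg (hρ0 _), mul_comm]
    exact mul_le_mul (hρK _) ((hglip _).trans (abs_sqrt_sub_le
      (Finset.sum_nonneg fun i _ => mul_self_nonneg _) hσ hε)) (abs_nonneg _) hK
  exact (abs_sub_le _ _ _).trans (add_le_add hXY hYΦ)

end AcceptanceComparison

section LogRatioAsymptotics

lemma tendsto_integral_min_one_of_locally_lipschitz {Ω : ℕ → Type*} [∀ d, MeasurableSpace (Ω d)]
    {μ : ∀ d, Measure (Ω d)} [∀ d, IsProbabilityMeasure (μ d)] {F S₁ S₂ S₃ : ∀ d, Ω d → ℝ}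
    (h1 : ∀ d, Integrable (fun ω => S₁ d ω ^ 2) (μ d))
    (h2 : ∀ d, Integrable (fun ω => S₂ d ω ^ 2) (μ d))
    (h3 : ∀ d, Integrable (fun ω => S₃ d ω ^ 2) (μ d))
    (n1 : ∀ d ω, 0 ≤ S₁ d ω) (n2 : ∀ d ω, 0 ≤ S₂ d ω) (n3 : ∀ d ω, 0 ≤ S₃ d ω)
    {δ : ℝ → ℝ → ℝ} (hδ : ∀ Rad : ℝ, ∃ K, ∀ a b : ℝ, |a| ≤ Rad → |b| ≤ Rad → δ a b ≤ K)
    (hF : ∀ᶠ d in atTop, ∀ ω, |F d ω| ≤ δ (S₁ d ω) (S₂ d ω) * S₃ d ω) {B : ℝ}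
    (b1 : ∀ᶠ d in atTop, ∫ ω, S₁ d ω ^ 2 ∂(μ d) ≤ B)
    (b2 : ∀ᶠ d in atTop, ∫ ω, S₂ d ω ^ 2 ∂(μ d) ≤ B)
    (b3 : Tendsto (fun d => ∫ ω, S₃ d ω ^ 2 ∂(μ d)) atTop (𝓝 0)) :
    Tendsto (fun d => ∫ ω, min 1 |F d ω| ∂(μ d)) atTop (𝓝 0) := by
  have hB : 0 ≤ B := by
    obtain ⟨d, hd⟩ := b1.exists
    exact (integral_nonneg fun ω => sq_nonneg _).trans hd
  rw [NormedAddGroup.tendsto_nhds_zero]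
  intro ε' hε'
  obtain ⟨ε, hε, rfl⟩ : ∃ ε, 0 < ε ∧ ε' = 4 * ε := ⟨ε' / 4, by positivity, by ring⟩
  set M : ℝ := B / ε + 1 with hM
  have hM1 : 1 ≤ M := by rw [hM]; have : 0 ≤ B / ε := by positivity
                         linarith
  have hBM : B / M ^ 2 ≤ ε := by
    rw [div_le_iff₀ (by positivity)]
    have : B = (M - 1) * ε := by rw [hM]; field_simp; ring
    nlinarith [mul_nonneg (sub_nonneg.2 hM1) hε.le]
  obtain ⟨K₀, hK₀⟩ := hδ M
  set K := max K₀ 0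
  have hK : 0 ≤ K := le_max_right _ _
  have hsmall : ∀ᶠ d in atTop, K ^ 2 / ε * ∫ ω, S₃ d ω ^ 2 ∂(μ d) < ε := by
    have := b3.const_mul (K ^ 2 / ε)
    rw [mul_zero] at this
    exact this.eventually_lt_const hε
  filter_upwards [hF, b1, b2, hsmall] with d hF b1 b2 hs
  have hnn : 0 ≤ ∫ ω, min 1 |F d ω| ∂(μ d) := integral_nonneg fun ω => by positivity
  rw [Real.norm_of_nonneg hnn]
  have hle : ∫ ω, min 1 |F d ω| ∂(μ d) ≤ ∫ ω, (S₁ d ω ^ 2 / M ^ 2 + S₂ d ω ^ 2 / M ^ 2 +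
      (ε + K ^ 2 / ε * S₃ d ω ^ 2)) ∂(μ d) := by
    refine integral_mono_of_nonneg (.of_forall fun ω => by positivity) (((h1 d).div_const _).add
      ((h2 d).div_const _) |>.add ((integrable_const ε).add ((h3 d).const_mul _)))
      (.of_forall fun ω => ?_)
    have p1 : 0 ≤ S₁ d ω ^ 2 / M ^ 2 := by positivity
    have p2 : 0 ≤ S₂ d ω ^ 2 / M ^ 2 := by positivity
    have p3 : 0 ≤ K ^ 2 / ε * S₃ d ω ^ 2 := by positivity
    have hbig {x : ℝ} (hx : M ≤ x) : 1 ≤ x ^ 2 / M ^ 2 := by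
      rw [le_div_iff₀ (by positivity), one_mul]
      exact pow_le_pow_left₀ (by positivity) hx 2
    change min 1 |F d ω| ≤ _
    rcases le_total M (S₁ d ω) with hc | hc
    · linarith [hbig hc, min_le_left 1 |F d ω|]
    rcases le_total M (S₂ d ω) with hc' | hc'
    · linarith [hbig hc', min_le_left 1 |F d ω|]
    have h4 : |F d ω| ≤ K * S₃ d ω := (hF ω).trans <|
      mul_le_mul_of_nonneg_right ((hK₀ _ _ (by rwa [abs_of_nonneg (n1 d ω)])
        (by rwa [abs_of_nonneg (n2 d ω)])).trans (le_max_left _ _)) (n3 d ω)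
    have h5 : K * S₃ d ω ≤ ε + K ^ 2 / ε * S₃ d ω ^ 2 := by
      have h6 : ε + K ^ 2 / ε * S₃ d ω ^ 2 - 2 * (K * S₃ d ω) = (ε - K * S₃ d ω) ^ 2 / ε := by
        field_simp; ring
      have h7 : 0 ≤ (ε - K * S₃ d ω) ^ 2 / ε := by positivity
      nlinarith [mul_nonneg hK (n3 d ω)]
    linarith [min_le_right 1 |F d ω|]
  rw [integral_add (((h1 d).div_const _).fun_add ((h2 d).div_const _))
    ((integrable_const ε).fun_add ((h3 d).const_mul _)), integral_add ((h1 d).div_const _)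
    ((h2 d).div_const _), integral_add (integrable_const ε) ((h3 d).const_mul _), integral_div,
    integral_div, integral_const_mul] at hle
  simp only [integral_const, probReal_univ, smul_eq_mul, one_mul] at hle
  have q1 : (∫ ω, S₁ d ω ^ 2 ∂(μ d)) / M ^ 2 ≤ B / M ^ 2 := by gcongr
  have q2 : (∫ ω, S₂ d ω ^ 2 ∂(μ d)) / M ^ 2 ≤ B / M ^ 2 := by gcongr
  linarith

variable {d : ℕ}

lemma measurePreserving_fst_prodGaussian :
    MeasurePreserving Prod.fst (prodGaussian d) (_root_.stdGaussian d) :=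
  measurePreserving_fst

lemma measurePreserving_snd_prodGaussian :
    MeasurePreserving Prod.snd (prodGaussian d) (_root_.stdGaussian d) :=
  measurePreserving_snd

lemma integral_comp_fst_prodGaussian {f : (Fin d → ℝ) → ℝ}
    (hf : AEStronglyMeasurable f (_root_.stdGaussian d)) :
    ∫ ω, f ω.1 ∂(prodGaussian d) = ∫ ζ, f ζ ∂(_root_.stdGaussian d) := by
  have h := measurePreserving_fst_prodGaussian (d := d)
  rw [← h.map_eq] at hf ⊢
  rw [integral_map h.aemeasurable hf]

lemma integral_comp_snd_prodGaussian {f : (Fin d → ℝ) → ℝ}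
    (hf : AEStronglyMeasurable f (_root_.stdGaussian d)) :
    ∫ ω, f ω.2 ∂(prodGaussian d) = ∫ ζ, f ζ ∂(_root_.stdGaussian d) := by
  have h := measurePreserving_snd_prodGaussian (d := d)
  rw [← h.map_eq] at hf ⊢
  rw [integral_map h.aemeasurable hf]

/-- Coefficients of the bilinear term of the SLA log-ratio, in terms of `θᵢ = hλᵢ²`. -/
noncomputable def crossCoeff (θ : Fin d → ℝ) (i : Fin d) : ℝ :=
  -(1 / 4) * (θ i * √(θ i)) * (1 - θ i / 2)

/-- The SLA log-ratio for the Gaussian target in spectral coordinates, with `θᵢ = hλᵢ²`. -/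
noncomputable def logRatio (θ : Fin d → ℝ) (ω : (Fin d → ℝ) × (Fin d → ℝ)) : ℝ :=
  ∑ i, (θ i ^ 2 / 8 * (ω.1 i ^ 2 - ω.2 i ^ 2) - θ i ^ 3 / 32 * ω.1 i ^ 2 +
    crossCoeff θ i * ω.1 i * ω.2 i)

/-- The component orthogonal to `p` of the vector `(crossCoeff θ i * ζ i)`. -/
noncomputable def crossPerp (θ p ζ : Fin d → ℝ) : Fin d → ℝ :=
  (fun i => crossCoeff θ i * ζ i) - (((fun i => p i * crossCoeff θ i) ⬝ᵥ ζ) • p)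

lemma measurable_logRatio (θ : Fin d → ℝ) : Measurable (logRatio θ) := by
  unfold logRatio; fun_prop

lemma measurable_crossPerp (θ p : Fin d → ℝ) : Measurable (crossPerp θ p) := by
  unfold crossPerp dotProduct; fun_prop

lemma dotProduct_crossCoeff (θ p ζ : Fin d → ℝ) :
    p ⬝ᵥ (fun i => crossCoeff θ i * ζ i) = (fun i => p i * crossCoeff θ i) ⬝ᵥ ζ := by
  simp [dotProduct, mul_assoc]

lemma dotProduct_crossPerp {θ p : Fin d → ℝ} (hp : p ⬝ᵥ p = 1) (ζ : Fin d → ℝ) :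
    p ⬝ᵥ crossPerp θ p ζ = 0 := by
  rw [crossPerp, dotProduct_sub, dotProduct_smul, hp, dotProduct_crossCoeff]
  simp

lemma crossPerp_dotProduct_self {θ p : Fin d → ℝ} (hp : p ⬝ᵥ p = 1) (ζ : Fin d → ℝ) :
    crossPerp θ p ζ ⬝ᵥ crossPerp θ p ζ =
      ∑ i, crossCoeff θ i ^ 2 * ζ i ^ 2 - ((fun i => p i * crossCoeff θ i) ⬝ᵥ ζ) ^ 2 := by
  have h := dotProduct_crossPerp (θ := θ) hp ζ
  conv_lhs => arg 1; rw [crossPerp]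
  rw [sub_dotProduct, smul_dotProduct, h, smul_zero, sub_zero, crossPerp, dotProduct_sub,
    dotProduct_smul, dotProduct_comm (fun i => crossCoeff θ i * ζ i) p,
    dotProduct_crossCoeff θ p, smul_eq_mul, ← sq]
  congr 1
  exact Finset.sum_congr rfl fun i _ => by ring

lemma crossCoeff_sq {θ : Fin d → ℝ} {i : Fin d} (h0 : 0 ≤ θ i) :
    crossCoeff θ i ^ 2 = θ i ^ 3 / 16 * (1 - θ i / 2) ^ 2 := by
  rw [crossCoeff]
  have := Real.sq_sqrt h0
  calc _ = (1 / 16) * (θ i ^ 2 * √(θ i) ^ 2) * (1 - θ i / 2) ^ 2 := by ring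
    _ = _ := by rw [this]; ring

section Bounds

variable {θ p : Fin d → ℝ} {Θ : ℝ}

lemma crossCoeff_sq_le (h0 : ∀ i, 0 ≤ θ i) (hle : ∀ i, θ i ≤ Θ) (hΘ : Θ ≤ 1) (i : Fin d) :
    crossCoeff θ i ^ 2 ≤ θ i ^ 3 / 16 := by
  rw [crossCoeff_sq (h0 i)]
  have h1 : (1 - θ i / 2) ^ 2 ≤ 1 := by nlinarith [h0 i, hle i]
  have h3 : 0 ≤ θ i ^ 3 / 16 := by have := h0 i; positivity
  exact mul_le_of_le_one_right h3 h1

lemma pow_three_le (h0 : ∀ i, 0 ≤ θ i) (hle : ∀ i, θ i ≤ Θ) (hΘ : Θ ≤ 1) (i : Fin d) :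
    θ i ^ 3 ≤ Θ := by
  have h1 := h0 i
  have h2 := (hle i).trans hΘ
  have h3 : θ i ^ 3 ≤ θ i := pow_le_of_le_one h1 h2 (by norm_num)
  exact h3.trans (hle i)

lemma dotProduct_mul_crossCoeff_le (hp : p ⬝ᵥ p = 1) (h0 : ∀ i, 0 ≤ θ i) (hle : ∀ i, θ i ≤ Θ)
    (hΘ : Θ ≤ 1) :
    (fun i => p i * crossCoeff θ i) ⬝ᵥ (fun i => p i * crossCoeff θ i) ≤ Θ := by
  calc _ ≤ ∑ i, p i * p i * Θ := by
        refine Finset.sum_le_sum fun i _ => ?_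
        have h1 := crossCoeff_sq_le h0 hle hΘ i
        have h2 := pow_three_le h0 hle hΘ i
        have h3 : 0 ≤ θ i ^ 3 := pow_nonneg (h0 i) 3
        have h4 : crossCoeff θ i ^ 2 ≤ Θ := by linarith
        nlinarith [mul_le_mul_of_nonneg_left h4 (mul_self_nonneg (p i))]
    _ = Θ := by rw [← Finset.sum_mul]; change (p ⬝ᵥ p) * Θ = Θ; rw [hp, one_mul]

/-- The variance of the square of a standard Gaussian. -/
noncomputable def sqVar : ℝ := Var[fun x => x ^ 2 - 1; gaussianReal 0 1]

lemma integral_abs_chaosSum_le {c : Fin d → ℝ} (hc : ∀ i, c i ^ 2 ≤ Θ * θ i ^ 3) :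
    ∫ ζ, |chaosSum c ζ| ∂(_root_.stdGaussian d) ≤ √(sqVar * (Θ * ∑ i, θ i ^ 3)) := by
  refine (integral_abs_le_sqrt (memLp_chaosSum c)).trans (Real.sqrt_le_sqrt ?_)
  have h : ∑ i, c i ^ 2 ≤ Θ * ∑ i, θ i ^ 3 := by
    rw [Finset.mul_sum]
    exact Finset.sum_le_sum fun i _ => hc i
  rw [integral_chaosSum_sq]
  exact mul_le_mul_of_nonneg_left h (variance_nonneg _ _)

lemma integrable_crossPerp_dotProduct_self (hp : p ⬝ᵥ p = 1) :
    Integrable (fun ζ => crossPerp θ p ζ ⬝ᵥ crossPerp θ p ζ) (_root_.stdGaussian d) := by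
  simp only [crossPerp_dotProduct_self hp]
  exact (integrable_sum_mul_sq _).sub (memLp_dotProduct _).integrable_sq

lemma integral_abs_crossPerp_sub_le (hp : p ⬝ᵥ p = 1) (h0 : ∀ i, 0 ≤ θ i) (hle : ∀ i, θ i ≤ Θ)
    (hΘ : Θ ≤ 1) (S : ℝ) :
    ∫ ζ, |crossPerp θ p ζ ⬝ᵥ crossPerp θ p ζ - S / 16| ∂(_root_.stdGaussian d) ≤
      √(sqVar * (Θ * ∑ i, θ i ^ 3)) + (|∑ i, θ i ^ 3 - S| + Θ * ∑ i, θ i ^ 3) + Θ := by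
  set b := fun i => p i * crossCoeff θ i with hb
  set c := fun i => crossCoeff θ i ^ 2 with hc
  have hi1 := (memLp_chaosSum c).integrable (by norm_num) |>.abs
  have hi2 := (memLp_dotProduct b).integrable_sq
  have hcs : ∀ i, c i ^ 2 ≤ Θ * θ i ^ 3 := fun i => by
    have h1 := crossCoeff_sq_le h0 hle hΘ i
    have h2 := pow_three_le h0 hle hΘ i
    have h3 : 0 ≤ θ i ^ 3 := pow_nonneg (h0 i) 3
    have h4 : 0 ≤ c i := sq_nonneg _
    calc c i ^ 2 = c i * c i := sq _
      _ ≤ Θ * θ i ^ 3 := mul_le_mul (by simp only [hc]; linarith) (by simp only [hc]; linarith) h4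
        (h3.trans h2)
  have hT : |∑ i, c i - S / 16| ≤ |∑ i, θ i ^ 3 - S| + Θ * ∑ i, θ i ^ 3 := by
    have h1 : |∑ i, (c i - θ i ^ 3 / 16)| ≤ Θ * ∑ i, θ i ^ 3 := by
      rw [Finset.mul_sum]
      refine (Finset.abs_sum_le_sum_abs _ _).trans (Finset.sum_le_sum fun i _ => ?_)
      have h3 : 0 ≤ θ i ^ 3 := pow_nonneg (h0 i) 3
      have h4 := h0 i
      have h5 := hle i
      simp only [hc, crossCoeff_sq (h0 i)]
      have h6 : θ i ^ 3 / 16 * (1 - θ i / 2) ^ 2 - θ i ^ 3 / 16 =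
          -(θ i ^ 3 * ((θ i - θ i ^ 2 / 4) / 16)) := by ring
      have h7 : 0 ≤ (θ i - θ i ^ 2 / 4) / 16 := by nlinarith
      rw [h6, abs_neg, abs_of_nonneg (mul_nonneg h3 h7), mul_comm Θ]
      refine mul_le_mul_of_nonneg_left ?_ h3
      nlinarith [sq_nonneg (θ i)]
    have h2 : ∑ i, c i - S / 16 =
        ∑ i, (c i - θ i ^ 3 / 16) + (∑ i, θ i ^ 3 - S) / 16 := by
      rw [Finset.sum_sub_distrib, ← Finset.sum_div]; ring
    rw [h2]
    refine (abs_add_le _ _).trans ?_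
    rw [abs_div, abs_of_pos (by norm_num : (0 : ℝ) < 16)]
    linarith [abs_nonneg (∑ i, θ i ^ 3 - S)]
  have hpt (ζ : Fin d → ℝ) : |crossPerp θ p ζ ⬝ᵥ crossPerp θ p ζ - S / 16| ≤
      |chaosSum c ζ| + |∑ i, c i - S / 16| + (b ⬝ᵥ ζ) ^ 2 := by
    rw [crossPerp_dotProduct_self hp]
    have h1 : ∑ i, crossCoeff θ i ^ 2 * ζ i ^ 2 = chaosSum c ζ + ∑ i, c i := by
      simp [chaosSum, hc, mul_sub]
    have h2 : ∑ i, crossCoeff θ i ^ 2 * ζ i ^ 2 - (b ⬝ᵥ ζ) ^ 2 - S / 16 =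
      chaosSum c ζ + (∑ i, c i - S / 16) + -(b ⬝ᵥ ζ) ^ 2 := by rw [h1]; ring
    rw [h2]
    refine (abs_add_le _ _).trans (add_le_add (abs_add_le _ _) ?_)
    rw [abs_neg, abs_of_nonneg (sq_nonneg _)]
  have h1 := integral_mono_of_nonneg (.of_forall fun ζ => abs_nonneg _)
    ((hi1.fun_add (integrable_const _)).fun_add hi2) (.of_forall hpt)
  rw [integral_add (hi1.fun_add (integrable_const _)) hi2, integral_add hi1 (integrable_const _),
    integral_dotProduct_sq] at h1
  simp only [integral_const, probReal_univ, smul_eq_mul, one_mul] at h1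
  have h2 := integral_abs_chaosSum_le hcs
  have h3 := dotProduct_mul_crossCoeff_le hp h0 hle hΘ
  linarith

lemma integral_min_one_logRatio_le (hp : p ⬝ᵥ p = 1) (h0 : ∀ i, 0 ≤ θ i) (hle : ∀ i, θ i ≤ Θ)
    (hΘ : Θ ≤ 1) (S : ℝ) {F : (Fin d → ℝ) × (Fin d → ℝ) → ℝ} (hF : Measurable F) :
    ∫ ω, min 1 |F ω + logRatio θ ω - (crossPerp θ p ω.1 ⬝ᵥ ω.2 - S / 32)| ∂(prodGaussian d) ≤
      ∫ ω, min 1 |F ω| ∂(prodGaussian d) + 3 * √(sqVar * (Θ * ∑ i, θ i ^ 3)) +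
        |∑ i, θ i ^ 3 - S| + √Θ := by
  set b := fun i => p i * crossCoeff θ i with hb
  set c := fun i => θ i ^ 2 / 8 with hc
  set c' := fun i => θ i ^ 3 / 32 with hc'
  have hi0 : Integrable (fun ω => min 1 |F ω|) (prodGaussian d) := by
    refine (integrable_const (1 : ℝ)).mono'
      (measurable_const.min hF.abs).aestronglyMeasurable (.of_forall fun ω => ?_)
    rw [Real.norm_of_nonneg (by positivity)]
    exact min_le_left _ _
  have hi1 (c : Fin d → ℝ) : Integrable (fun ζ => |chaosSum c ζ|) (_root_.stdGaussian d) :=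
    (memLp_chaosSum c).integrable (by norm_num) |>.abs
  have hi1f (c : Fin d → ℝ) : Integrable (fun ω => |chaosSum c ω.1|) (prodGaussian d) :=
    measurePreserving_fst_prodGaussian.integrable_comp_of_integrable (hi1 c)
  have hi1s (c : Fin d → ℝ) : Integrable (fun ω => |chaosSum c ω.2|) (prodGaussian d) :=
    measurePreserving_snd_prodGaussian.integrable_comp_of_integrable (hi1 c)
  have hsq : Integrable (fun ω : (Fin d → ℝ) × (Fin d → ℝ) => ((b ⬝ᵥ ω.1) * (p ⬝ᵥ ω.2)) ^ 2)
      (prodGaussian d) := by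
    simp only [mul_pow]
    exact (memLp_dotProduct b).integrable_sq.mul_prod (memLp_dotProduct p).integrable_sq
  have hmem : MemLp (fun ω : (Fin d → ℝ) × (Fin d → ℝ) => (b ⬝ᵥ ω.1) * (p ⬝ᵥ ω.2)) 2
      (prodGaussian d) := by
    refine (memLp_two_iff_integrable_sq ?_).2 hsq
    exact (((measurable_dotProduct b).comp measurable_fst).mul
      ((measurable_dotProduct p).comp measurable_snd)).aestronglyMeasurable
  have hi3 := (hmem.integrable (by norm_num)).abs
  have hb3 : ∫ ω : (Fin d → ℝ) × (Fin d → ℝ), |(b ⬝ᵥ ω.1) * (p ⬝ᵥ ω.2)| ∂(prodGaussian d) ≤ √Θ := by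
    refine (integral_abs_le_sqrt hmem).trans (Real.sqrt_le_sqrt ?_)
    simp only [mul_pow]
    rw [prodGaussian, integral_prod_mul (fun ζ => (b ⬝ᵥ ζ) ^ 2) fun η => (p ⬝ᵥ η) ^ 2,
      integral_dotProduct_sq, integral_dotProduct_sq, hp, mul_one]
    exact dotProduct_mul_crossCoeff_le hp h0 hle hΘ
  have hcs : ∀ i, c i ^ 2 ≤ Θ * θ i ^ 3 := fun i => by
    have h4 := h0 i
    have h3 : 0 ≤ θ i ^ 3 := pow_nonneg h4 3
    calc c i ^ 2 = θ i / 64 * θ i ^ 3 := by simp only [hc]; ring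
      _ ≤ Θ * θ i ^ 3 := mul_le_mul_of_nonneg_right (by linarith [hle i]) h3
  have hcs' : ∀ i, c' i ^ 2 ≤ Θ * θ i ^ 3 := fun i => by
    have h3 : 0 ≤ θ i ^ 3 := pow_nonneg (h0 i) 3
    calc c' i ^ 2 = θ i ^ 3 / 1024 * θ i ^ 3 := by simp only [hc']; ring
      _ ≤ Θ * θ i ^ 3 := mul_le_mul_of_nonneg_right (by linarith [pow_three_le h0 hle hΘ i]) h3
  have hpt (ω : (Fin d → ℝ) × (Fin d → ℝ)) :
      min 1 |F ω + logRatio θ ω - (crossPerp θ p ω.1 ⬝ᵥ ω.2 - S / 32)| ≤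
      min 1 |F ω| + (|chaosSum c ω.1| + |chaosSum c ω.2| + |chaosSum c' ω.1|) +
        |∑ i, θ i ^ 3 - S| + |(b ⬝ᵥ ω.1) * (p ⬝ᵥ ω.2)| := by
    set G := chaosSum c ω.1 - chaosSum c ω.2 - chaosSum c' ω.1 - (∑ i, θ i ^ 3 - S) / 32 +
      (b ⬝ᵥ ω.1) * (p ⬝ᵥ ω.2) with hG
    have h1 : F ω + logRatio θ ω - (crossPerp θ p ω.1 ⬝ᵥ ω.2 - S / 32) = F ω + G := by
      have h2 : crossPerp θ p ω.1 ⬝ᵥ ω.2 =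
          ∑ i, crossCoeff θ i * ω.1 i * ω.2 i - (b ⬝ᵥ ω.1) * (p ⬝ᵥ ω.2) := by
        rw [crossPerp, sub_dotProduct, smul_dotProduct, smul_eq_mul]; rfl
      have h3 : logRatio θ ω = chaosSum c ω.1 - chaosSum c ω.2 - chaosSum c' ω.1 -
          ∑ i, c' i + ∑ i, crossCoeff θ i * ω.1 i * ω.2 i := by
        simp only [logRatio, chaosSum, ← Finset.sum_sub_distrib, ← Finset.sum_add_distrib]
        refine Finset.sum_congr rfl fun i _ => ?_
        simp only [hc, hc']; ring
      rw [h2, h3, hG, hc', ← Finset.sum_div]; ring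
    have h4 : |G| ≤ |chaosSum c ω.1| + |chaosSum c ω.2| + |chaosSum c' ω.1| +
        |∑ i, θ i ^ 3 - S| + |(b ⬝ᵥ ω.1) * (p ⬝ᵥ ω.2)| := by
      rw [hG]
      refine (abs_add_le _ _).trans (add_le_add_left ?_ _)
      refine (abs_sub _ _).trans (add_le_add ?_ ?_)
      · exact (abs_sub _ _).trans (add_le_add_left (abs_sub _ _) _)
      · rw [abs_div, abs_of_pos (by norm_num : (0 : ℝ) < 32)]
        linarith [abs_nonneg (∑ i, θ i ^ 3 - S)]
    rw [h1]
    have h5 : min 1 |F ω + G| ≤ min 1 |F ω| + |G| := by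
      have := abs_add_le (F ω) G
      rcases le_total 1 |F ω| with h | h
      · rw [min_eq_left h]; linarith [min_le_left 1 |F ω + G|, abs_nonneg G]
      · rw [min_eq_right h]; linarith [min_le_right 1 |F ω + G|]
    linarith
  have hI1 := ((hi1f c).fun_add (hi1s c)).fun_add (hi1f c')
  have hI2 := hi0.fun_add hI1
  have hI3 := hI2.fun_add (integrable_const |∑ i, θ i ^ 3 - S|)
  have h1 := integral_mono_of_nonneg (.of_forall fun ζ => by positivity)
    (hI3.fun_add hi3) (.of_forall hpt)
  rw [integral_add hI3 hi3, integral_add hI2 (integrable_const _), integral_add hi0 hI1,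
    integral_add ((hi1f c).fun_add (hi1s c)) (hi1f c'), integral_add (hi1f c) (hi1s c),
    integral_comp_fst_prodGaussian (hi1 c).aestronglyMeasurable,
    integral_comp_snd_prodGaussian (hi1 c).aestronglyMeasurable,
    integral_comp_fst_prodGaussian (hi1 c').aestronglyMeasurable] at h1
  simp only [integral_const, probReal_univ, smul_eq_mul, one_mul] at h1
  have h2 := integral_abs_chaosSum_le hcs
  have h3 := integral_abs_chaosSum_le hcs'
  linarith

end Bounds

end LogRatioAsymptotics

section AcceptanceLimit

variable {θ p : ∀ d, Fin d → ℝ} {Θ : ℕ → ℝ} {S K : ℝ} {ρ : ∀ d, (Fin d → ℝ) → ℝ}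
  {F : ∀ d, (Fin d → ℝ) × (Fin d → ℝ) → ℝ}

/-- Limit of the mean acceptance probability, weighted by a function of a fixed direction `p`. -/
lemma tendsto_integral_weight_mul_acc (hθ0 : ∀ d i, 0 ≤ θ d i) (hθ : ∀ d i, θ d i ≤ Θ d)
    (hΘ : Tendsto Θ atTop (𝓝 0)) (hS : Tendsto (fun d => ∑ i, θ d i ^ 3) atTop (𝓝 S))
    (hp : ∀ᶠ d in atTop, p d ⬝ᵥ p d = 1) {w : ℝ → ℝ} (hw : Measurable w)
    (hw0 : ∀ x, 0 ≤ w x) (hw1 : ∫ x, w x ∂(gaussianReal 0 1) = 1)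
    (hw2 : Integrable (fun x => w x ^ 2) (gaussianReal 0 1))
    (hρ : ∀ d, Measurable (ρ d)) (hρ0 : ∀ d ζ, 0 ≤ ρ d ζ) (hρK : ∀ᶠ d in atTop, ∀ ζ, ρ d ζ ≤ K)
    (hρ1 : ∀ d, ∫ ζ, ρ d ζ ∂(_root_.stdGaussian d) = 1) (hF : ∀ d, Measurable (F d))
    (hF0 : Tendsto (fun d => ∫ ω, min 1 |F d ω| ∂(prodGaussian d)) atTop (𝓝 0)) :
    Tendsto (fun d => ∫ ω, w (p d ⬝ᵥ ω.2) * acc (F d ω + logRatio (θ d) ω) * ρ d ω.1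
      ∂(prodGaussian d)) atTop (𝓝 (2 * Phi (-(√S / 4) / 2))) := by
  have hS0 : 0 ≤ S := ge_of_tendsto' hS fun d =>
    Finset.sum_nonneg fun i _ => pow_nonneg (hθ0 d i) 3
  have hK : 0 ≤ K := by
    obtain ⟨d, hd⟩ := hρK.exists
    exact (hρ0 d 0).trans (hd 0)
  have hσ : 0 ≤ √S / 4 := by positivity
  have hσ2 : (√S / 4) ^ 2 = S / 16 := by rw [div_pow, Real.sq_sqrt hS0]; norm_num
  set V : ℝ := ∫ x, w x ^ 2 ∂(gaussianReal 0 1) with hV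
  have hV0 : 0 ≤ V := integral_nonneg fun x => sq_nonneg _
  have hroot : Tendsto (fun d => √(sqVar * (Θ d * ∑ i, θ d i ^ 3))) atTop (𝓝 0) := by
    have h := ((hΘ.mul hS).const_mul sqVar).sqrt
    simpa using h
  have habs : Tendsto (fun d => |∑ i, θ d i ^ 3 - S|) atTop (𝓝 0) := by
    simpa using (hS.sub_const S).abs
  have hG : Tendsto (fun d => ∫ ω, min 1 |F d ω| ∂(prodGaussian d) +
      3 * √(sqVar * (Θ d * ∑ i, θ d i ^ 3)) + |∑ i, θ d i ^ 3 - S| + √(Θ d)) atTop (𝓝 0) := by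
    simpa using ((hF0.add (hroot.const_mul 3)).add habs).add hΘ.sqrt
  have hH : Tendsto (fun d => √(sqVar * (Θ d * ∑ i, θ d i ^ 3)) +
      (|∑ i, θ d i ^ 3 - S| + Θ d * ∑ i, θ d i ^ 3) + Θ d) atTop (𝓝 0) := by
    simpa using (hroot.add (habs.add (hΘ.mul hS))).add hΘ
  rw [Metric.tendsto_nhds]
  intro ε' hε'
  set ε : ℝ := ε' / (2 * (K * (V + 1) + 1)) with hεdef
  have hden : 0 < K * (V + 1) + 1 := by positivity
  have hε : 0 < ε := by positivity
  have hεK : K * (V + 1) * ε ≤ ε' / 2 := by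
    have : ε' / 2 = (K * (V + 1) + 1) * ε := by rw [hεdef]; field_simp
    nlinarith
  have hlim := ((hG.div_const ε).add (hH.div_const ε)).const_mul K
  simp only [zero_div, add_zero, mul_zero] at hlim
  filter_upwards [hp, hρK, hlim.eventually_lt_const (half_pos hε'),
    hΘ.eventually_le_const one_pos] with d hp hρK hlt hΘ1
  have hcore := abs_integral_acc_sub_le hp hw hw0 hw1 hw2 (hρ d) (hρ0 d) hρK (hρ1 d)
    ((hF d).add (measurable_logRatio (θ d))) (measurable_crossPerp (θ d) (p d))
    (dotProduct_crossPerp hp) hσ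
    (((integrable_crossPerp_dotProduct_self hp).sub (integrable_const _)).abs) hε
  have h1 := integral_abs_crossPerp_sub_le hp (hθ0 d) (hθ d) hΘ1 S
  have h2 := integral_min_one_logRatio_le hp (hθ0 d) (hθ d) hΘ1 S (hF d)
  rw [hσ2, show S / 16 / 2 = S / 32 by ring] at hcore
  rw [Real.dist_eq]
  refine hcore.trans_lt ?_
  simp only [Pi.add_apply]
  have h1' := mul_le_mul_of_nonneg_left (div_le_div_of_nonneg_right h1 hε.le) hK
  have h2' := mul_le_mul_of_nonneg_left (div_le_div_of_nonneg_right h2 hε.le) hK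
  linarith

/-- Limit of the mean acceptance probability. -/
lemma tendsto_integral_acc (hθ0 : ∀ d i, 0 ≤ θ d i) (hθ : ∀ d i, θ d i ≤ Θ d)
    (hΘ : Tendsto Θ atTop (𝓝 0)) (hS : Tendsto (fun d => ∑ i, θ d i ^ 3) atTop (𝓝 S))
    (hp : ∀ᶠ d in atTop, p d ⬝ᵥ p d = 1)
    (hρ : ∀ d, Measurable (ρ d)) (hρ0 : ∀ d ζ, 0 ≤ ρ d ζ) (hρK : ∀ᶠ d in atTop, ∀ ζ, ρ d ζ ≤ K)
    (hρ1 : ∀ d, ∫ ζ, ρ d ζ ∂(_root_.stdGaussian d) = 1) (hF : ∀ d, Measurable (F d))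
    (hF0 : Tendsto (fun d => ∫ ω, min 1 |F d ω| ∂(prodGaussian d)) atTop (𝓝 0)) :
    Tendsto (fun d => ∫ ω, acc (F d ω + logRatio (θ d) ω) * ρ d ω.1
      ∂(prodGaussian d)) atTop (𝓝 (2 * Phi (-(√S / 4) / 2))) := by
  simpa using tendsto_integral_weight_mul_acc hθ0 hθ hΘ hS hp (w := fun _ => 1) measurable_const
    (fun _ => zero_le_one) (by simp) (by simp) hρ hρ0 hρK hρ1 hF hF0

/-- Limit of the rescaled mean squared jump in the direction `p`. -/
lemma tendsto_integral_sq_jump_mul_acc (hθ0 : ∀ d i, 0 ≤ θ d i) (hθ : ∀ d i, θ d i ≤ Θ d)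
    (hΘ : Tendsto Θ atTop (𝓝 0)) (hS : Tendsto (fun d => ∑ i, θ d i ^ 3) atTop (𝓝 S))
    (hp : ∀ᶠ d in atTop, p d ⬝ᵥ p d = 1)
    (hρ : ∀ d, Measurable (ρ d)) (hρ0 : ∀ d ζ, 0 ≤ ρ d ζ) (hρK : ∀ᶠ d in atTop, ∀ ζ, ρ d ζ ≤ K)
    (hρ1 : ∀ d, ∫ ζ, ρ d ζ ∂(_root_.stdGaussian d) = 1) (hF : ∀ d, Measurable (F d))
    (hF0 : Tendsto (fun d => ∫ ω, min 1 |F d ω| ∂(prodGaussian d)) atTop (𝓝 0)) :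
    Tendsto (fun d => ∫ ω, (p d ⬝ᵥ ω.2 - (fun i => √(θ d i) / 2 * p d i) ⬝ᵥ ω.1) ^ 2 *
      acc (F d ω + logRatio (θ d) ω) * ρ d ω.1 ∂(prodGaussian d)) atTop
      (𝓝 (2 * Phi (-(√S / 4) / 2))) := by
  have hmain := tendsto_integral_weight_mul_acc hθ0 hθ hΘ hS hp (w := fun x => x ^ 2)
    (by fun_prop) (fun x => sq_nonneg x) integral_sq_gaussianReal
    ((integrable_pow_gaussianReal 4).congr (.of_forall fun x => by ring)) hρ hρ0 hρK hρ1 hF hF0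
  have hK : 0 ≤ K := by
    obtain ⟨d, hd⟩ := hρK.exists
    exact (hρ0 d 0).trans (hd 0)
  have hbound : Tendsto (fun d => K * (Θ d + 2 * √(Θ d))) atTop (𝓝 0) := by
    simpa using (hΘ.add (hΘ.sqrt.const_mul 2)).const_mul K
  refine tendsto_of_tendsto_of_dist hmain (squeeze_zero' (.of_forall fun d => dist_nonneg) ?_ hbound)
  filter_upwards [hp, hρK] with d hp hρK
  set a : Fin d → ℝ := fun i => √(θ d i) / 2 * p d i with ha
  have haa : a ⬝ᵥ a ≤ Θ d := by
    calc a ⬝ᵥ a ≤ ∑ i, Θ d * (p d i * p d i) := by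
          refine Finset.sum_le_sum fun i _ => ?_
          have h1 : a i * a i = θ d i / 4 * (p d i * p d i) := by
            calc a i * a i = √(θ d i) ^ 2 / 4 * (p d i * p d i) := by simp only [ha]; ring
              _ = _ := by rw [Real.sq_sqrt (hθ0 d i)]
          rw [h1]
          exact mul_le_mul_of_nonneg_right (by linarith [hθ0 d i, hθ d i]) (mul_self_nonneg _)
      _ = Θ d := by rw [← Finset.mul_sum]; change Θ d * (p d ⬝ᵥ p d) = Θ d; rw [hp, mul_one]
  set T : (Fin d → ℝ) × (Fin d → ℝ) → ℝ := fun ω => acc (F d ω + logRatio (θ d) ω) * ρ d ω.1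
    with hT
  have hTm : Measurable T :=
    (measurable_acc.comp ((hF d).add (measurable_logRatio (θ d)))).mul
      ((hρ d).comp measurable_fst)
  have hT0 (ω) : 0 ≤ T ω := mul_nonneg (acc_nonneg _) (hρ0 d _)
  have hTK (ω) : T ω ≤ K :=
    (mul_le_of_le_one_left (hρ0 d _) (acc_le_one _)).trans (hρK _)
  have hTn (ω) : ‖T ω‖ ≤ K := by rw [Real.norm_of_nonneg (hT0 ω)]; exact hTK ω
  have hM : Integrable (fun ω : (Fin d → ℝ) × (Fin d → ℝ) => (a ⬝ᵥ ω.1) ^ 2) (prodGaussian d) :=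
    measurePreserving_fst_prodGaussian.integrable_comp_of_integrable
      (memLp_dotProduct a).integrable_sq
  have hN : Integrable (fun ω : (Fin d → ℝ) × (Fin d → ℝ) => (p d ⬝ᵥ ω.2) ^ 2) (prodGaussian d) :=
    measurePreserving_snd_prodGaussian.integrable_comp_of_integrable
      (memLp_dotProduct (p d)).integrable_sq
  have hsq : Integrable (fun ω : (Fin d → ℝ) × (Fin d → ℝ) => ((a ⬝ᵥ ω.1) * (p d ⬝ᵥ ω.2)) ^ 2)
      (prodGaussian d) := by
    simp only [mul_pow]
    exact (memLp_dotProduct a).integrable_sq.mul_prod (memLp_dotProduct (p d)).integrable_sq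
  have hmem : MemLp (fun ω : (Fin d → ℝ) × (Fin d → ℝ) => (a ⬝ᵥ ω.1) * (p d ⬝ᵥ ω.2)) 2
      (prodGaussian d) := by
    refine (memLp_two_iff_integrable_sq ?_).2 hsq
    exact (((measurable_dotProduct a).comp measurable_fst).mul
      ((measurable_dotProduct (p d)).comp measurable_snd)).aestronglyMeasurable
  have hMN := hmem.integrable (by norm_num)
  have hJ : Integrable (fun ω : (Fin d → ℝ) × (Fin d → ℝ) => (p d ⬝ᵥ ω.2 - a ⬝ᵥ ω.1) ^ 2)
      (prodGaussian d) :=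
    ((hN.add hM).sub (hMN.const_mul 2)).congr (.of_forall fun ω => by
      simp only [Pi.add_apply, Pi.sub_apply]; ring)
  have hbM : ∫ ω : (Fin d → ℝ) × (Fin d → ℝ), (a ⬝ᵥ ω.1) ^ 2 ∂(prodGaussian d) ≤ Θ d := by
    rw [integral_comp_fst_prodGaussian (memLp_dotProduct a).integrable_sq.aestronglyMeasurable,
      integral_dotProduct_sq]
    exact haa
  have hbMN : ∫ ω : (Fin d → ℝ) × (Fin d → ℝ), |(a ⬝ᵥ ω.1) * (p d ⬝ᵥ ω.2)| ∂(prodGaussian d) ≤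
      √(Θ d) := by
    refine (integral_abs_le_sqrt hmem).trans (Real.sqrt_le_sqrt ?_)
    simp only [mul_pow]
    rw [prodGaussian, integral_prod_mul (fun ζ => (a ⬝ᵥ ζ) ^ 2) fun η => (p d ⬝ᵥ η) ^ 2,
      integral_dotProduct_sq, integral_dotProduct_sq, hp, mul_one]
    exact haa
  simp only [mul_assoc]
  rw [Real.dist_eq, ← integral_sub (hN.mul_bdd hTm.aestronglyMeasurable (.of_forall hTn))
    (hJ.mul_bdd hTm.aestronglyMeasurable (.of_forall hTn))]
  refine (abs_integral_le_integral_abs).trans ?_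
  have hle := integral_mono_of_nonneg (μ := prodGaussian d)
    (f := fun ω => |(p d ⬝ᵥ ω.2) ^ 2 * T ω - (p d ⬝ᵥ ω.2 - a ⬝ᵥ ω.1) ^ 2 * T ω|)
    (g := fun ω => K * ((a ⬝ᵥ ω.1) ^ 2 + 2 * |(a ⬝ᵥ ω.1) * (p d ⬝ᵥ ω.2)|))
    (.of_forall fun ω => abs_nonneg _)
    ((hM.fun_add (hMN.abs.const_mul 2)).const_mul K) (.of_forall fun ω => by
      have h1 : (p d ⬝ᵥ ω.2) ^ 2 * T ω - (p d ⬝ᵥ ω.2 - a ⬝ᵥ ω.1) ^ 2 * T ω =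
        T ω * (2 * ((a ⬝ᵥ ω.1) * (p d ⬝ᵥ ω.2)) - (a ⬝ᵥ ω.1) ^ 2) := by ring
      simp only
      rw [h1, abs_mul, abs_of_nonneg (hT0 ω)]
      refine mul_le_mul (hTK ω) ?_ (abs_nonneg _) hK
      refine (abs_sub _ _).trans ?_
      rw [abs_mul, abs_two, abs_of_nonneg (sq_nonneg (a ⬝ᵥ ω.1)), add_comm])
  rw [integral_const_mul, integral_add hM (hMN.abs.const_mul 2), integral_const_mul] at hle
  refine hle.trans (mul_le_mul_of_nonneg_left ?_ hK)
  linarith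

end AcceptanceLimit

section SpectralCoordinates

variable {d : ℕ} {A Q R : Matrix (Fin d) (Fin d) ℝ} {lam : Fin d → ℝ}

lemma mulVec_dotProduct_mulVec_of_transpose_mul_self (hQ : Qᵀ * Q = 1) (u v : Fin d → ℝ) :
    Q *ᵥ u ⬝ᵥ Q *ᵥ v = u ⬝ᵥ v := by
  rw [dotProduct_mulVec, vecMul_mulVec, ← dotProduct_mulVec, hQ, one_mulVec]

lemma eq_conj_diagonal (hQ : Qᵀ * Q = 1) (hdA : (Qᵀ * A * Q).IsDiag)
    (hlam : ∀ i, lam i ^ 2 = (Qᵀ * A * Q) i i) :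
    A = Q * diagonal (fun i => lam i ^ 2) * Qᵀ := by
  have hQ' : Q * Qᵀ = 1 := mul_eq_one_comm.1 hQ
  have h : diagonal (fun i => lam i ^ 2) = Qᵀ * A * Q := by
    rw [← hdA.diagonal_diag]
    congr 1
    exact funext hlam
  rw [h, show Q * (Qᵀ * A * Q) * Qᵀ = (Q * Qᵀ) * A * (Q * Qᵀ) by noncomm_ring, hQ', one_mul, mul_one]

lemma inv_conj_diagonal (hQ : Qᵀ * Q = 1) (hpos : ∀ i, 0 < lam i) :
    (Q * diagonal (fun i => lam i ^ 2) * Qᵀ)⁻¹ = Q * diagonal (fun i => (lam i ^ 2)⁻¹) * Qᵀ := by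
  have hQ' : Q * Qᵀ = 1 := mul_eq_one_comm.1 hQ
  refine inv_eq_right_inv ?_
  rw [show Q * diagonal (fun i => lam i ^ 2) * Qᵀ * (Q * diagonal (fun i => (lam i ^ 2)⁻¹) * Qᵀ) =
    Q * (diagonal (fun i => lam i ^ 2) * (Qᵀ * Q) * diagonal (fun i => (lam i ^ 2)⁻¹)) * Qᵀ by
    noncomm_ring, hQ, mul_one, diagonal_mul_diagonal]
  have h : (diagonal fun i => lam i ^ 2 * (lam i ^ 2)⁻¹) = (1 : Matrix (Fin d) (Fin d) ℝ) := by
    rw [← diagonal_one]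
    congr 1
    exact funext fun i => mul_inv_cancel₀ (pow_pos (hpos i) 2).ne'
  rw [h, mul_one, hQ']

/-- The whitening rotation `diag(λ) Qᵀ R`. -/
def whiten (Q R : Matrix (Fin d) (Fin d) ℝ) (lam : Fin d → ℝ) : Matrix (Fin d) (Fin d) ℝ :=
  diagonal lam * Qᵀ * R

lemma whiten_mul_transpose (hQ : Qᵀ * Q = 1) (hpos : ∀ i, 0 < lam i)
    (hR : R * Rᵀ = (Q * diagonal (fun i => lam i ^ 2) * Qᵀ)⁻¹) :
    whiten Q R lam * (whiten Q R lam)ᵀ = 1 := by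
  rw [inv_conj_diagonal hQ hpos] at hR
  rw [whiten, transpose_mul, transpose_mul, transpose_transpose, diagonal_transpose,
    show diagonal lam * Qᵀ * R * (Rᵀ * (Q * diagonal lam)) =
      diagonal lam * Qᵀ * (R * Rᵀ) * Q * diagonal lam by noncomm_ring, hR,
    show diagonal lam * Qᵀ * (Q * diagonal (fun i => (lam i ^ 2)⁻¹) * Qᵀ) * Q * diagonal lam =
      diagonal lam * (Qᵀ * Q) * diagonal (fun i => (lam i ^ 2)⁻¹) * (Qᵀ * Q) * diagonal lam by
      noncomm_ring, hQ, mul_one, mul_one, diagonal_mul_diagonal, diagonal_mul_diagonal,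
    ← diagonal_one]
  congr 1
  funext i
  have := (hpos i).ne'
  field_simp

/-- The state with whitened spectral coordinates `ζ`. -/
noncomputable def specState (A Q : Matrix (Fin d) (Fin d) ℝ) (b lam ζ : Fin d → ℝ) : Fin d → ℝ :=
  A⁻¹ *ᵥ b + Q *ᵥ fun i => ζ i / lam i

/-- Spectral coordinates of the proposal, relative to `A⁻¹b`. -/
noncomputable def propCoord (lam : Fin d → ℝ) (h : ℝ) (ω : (Fin d → ℝ) × (Fin d → ℝ)) (i : Fin d) : ℝ :=
  (1 - h * lam i ^ 2 / 2) * (ω.1 i / lam i) + √h * ω.2 i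

/-- The proposal in terms of whitened spectral coordinates. -/
noncomputable def specProposal (A Q : Matrix (Fin d) (Fin d) ℝ) (b lam : Fin d → ℝ) (h : ℝ)
    (ω : (Fin d → ℝ) × (Fin d → ℝ)) : Fin d → ℝ :=
  A⁻¹ *ᵥ b + Q *ᵥ propCoord lam h ω

lemma xeq_eq_specState (hQ : Qᵀ * Q = 1) (hpos : ∀ i, 0 < lam i) (b ξ : Fin d → ℝ) :
    xeq A b R ξ = specState A Q b lam (whiten Q R lam *ᵥ ξ) := by
  have hQ' : Q * Qᵀ = 1 := mul_eq_one_comm.1 hQ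
  have h : (fun i => (whiten Q R lam *ᵥ ξ) i / lam i) = Qᵀ *ᵥ (R *ᵥ ξ) := by
    funext i
    rw [whiten, ← mulVec_mulVec, ← mulVec_mulVec, mulVec_diagonal,
      mul_div_cancel_left₀ _ (hpos i).ne']
  rw [xeq, specState, h, mulVec_mulVec, hQ', one_mulVec]

lemma conj_diagonal_mulVec (hQ : Qᵀ * Q = 1) (c u : Fin d → ℝ) :
    (Q * diagonal c * Qᵀ) *ᵥ (Q *ᵥ u) = Q *ᵥ fun i => c i * u i := by
  rw [mulVec_mulVec, show Q * diagonal c * Qᵀ * Q = Q * diagonal c * (Qᵀ * Q) by noncomm_ring, hQ,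
    mul_one, ← mulVec_mulVec]
  congr 1
  exact funext fun i => mulVec_diagonal _ _ _

lemma snorm_mulVec (hQ : Qᵀ * Q = 1) (s : ℝ) (u : Fin d → ℝ) :
    snorm Q lam s (Q *ᵥ u) = √(∑ i, (lam i ^ (2 * s) * u i) ^ 2) := by
  rw [snorm, Apow, conj_diagonal_mulVec hQ, mulVec_dotProduct_mulVec_of_transpose_mul_self hQ]
  simp [dotProduct, sq]

lemma mulVec_inv_add (hQ : Qᵀ * Q = 1) (hA : A = Q * diagonal (fun i => lam i ^ 2) * Qᵀ)
    (hdet : IsUnit A.det) (b u : Fin d → ℝ) :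
    A *ᵥ (A⁻¹ *ᵥ b + Q *ᵥ u) = b + Q *ᵥ fun i => lam i ^ 2 * u i := by
  rw [mulVec_add, mulVec_mulVec, mul_nonsing_inv _ hdet, one_mulVec]
  congr 1
  conv_lhs => rw [hA]
  exact conj_diagonal_mulVec hQ _ _

lemma sub_langevin_eq (hQ : Qᵀ * Q = 1) (hA : A = Q * diagonal (fun i => lam i ^ 2) * Qᵀ)
    (hdet : IsUnit A.det) (b : Fin d → ℝ) (h : ℝ) (u v : Fin d → ℝ) :
    (A⁻¹ *ᵥ b + Q *ᵥ v) - (1 - (h / 2) • A) *ᵥ (A⁻¹ *ᵥ b + Q *ᵥ u) - (h / 2) • b =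
      Q *ᵥ fun i => v i - u i + h * lam i ^ 2 / 2 * u i := by
  have e : (Q *ᵥ fun i => v i - u i + h * lam i ^ 2 / 2 * u i) =
      Q *ᵥ v - Q *ᵥ u + (h / 2) • Q *ᵥ fun i => lam i ^ 2 * u i := by
    rw [← mulVec_smul, ← mulVec_sub, ← mulVec_add]
    congr 1
    funext i
    simp only [Pi.add_apply, Pi.sub_apply, Pi.smul_apply, smul_eq_mul]
    ring
  rw [e, sub_mulVec, one_mulVec, smul_mulVec, mulVec_inv_add hQ hA hdet, smul_add]
  abel

lemma ySLA_specState (hQ : Qᵀ * Q = 1) (hA : A = Q * diagonal (fun i => lam i ^ 2) * Qᵀ)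
    (hdet : IsUnit A.det) (b : Fin d → ℝ) (h : ℝ) (ζ η : Fin d → ℝ) :
    ySLA A b h (specState A Q b lam ζ) η = specProposal A Q b lam h (ζ, Qᵀ *ᵥ η) := by
  have hQ' : Q * Qᵀ = 1 := mul_eq_one_comm.1 hQ
  have h1 := sub_langevin_eq hQ hA hdet b h (fun i => ζ i / lam i)
    (propCoord lam h (ζ, Qᵀ *ᵥ η))
  have h2 : (fun i => propCoord lam h (ζ, Qᵀ *ᵥ η) i - ζ i / lam i +
      h * lam i ^ 2 / 2 * (ζ i / lam i)) = √h • Qᵀ *ᵥ η := by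
    funext i
    simp only [propCoord, Pi.smul_apply, smul_eq_mul]
    ring
  rw [h2, mulVec_smul, mulVec_mulVec, hQ', one_mulVec] at h1
  rw [ySLA, specProposal, specState, ← h1]
  abel

lemma gaussian_log_density_eq (hQ : Qᵀ * Q = 1)
    (hA : A = Q * diagonal (fun i => lam i ^ 2) * Qᵀ)
    (hdet : IsUnit A.det) (b u : Fin d → ℝ) :
    -(1/2) * ((A⁻¹ *ᵥ b + Q *ᵥ u) ⬝ᵥ A *ᵥ (A⁻¹ *ᵥ b + Q *ᵥ u)) + b ⬝ᵥ (A⁻¹ *ᵥ b + Q *ᵥ u) =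
      1 / 2 * (b ⬝ᵥ A⁻¹ *ᵥ b) - 1 / 2 * ∑ i, lam i ^ 2 * u i ^ 2 := by
  have hsymm : Aᵀ = A := by
    rw [hA, transpose_mul, transpose_mul, transpose_transpose, diagonal_transpose, mul_assoc]
  have h1 : (A⁻¹ *ᵥ b) ⬝ᵥ (Q *ᵥ fun i => lam i ^ 2 * u i) = b ⬝ᵥ Q *ᵥ u := by
    have h2 : (Q *ᵥ fun i => lam i ^ 2 * u i) = A *ᵥ (Q *ᵥ u) := by
      conv_rhs => rw [hA]
      exact (conj_diagonal_mulVec hQ _ _).symm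
    rw [h2, dotProduct_mulVec, ← mulVec_transpose, hsymm, mulVec_mulVec, mul_nonsing_inv _ hdet,
      one_mulVec]
  rw [mulVec_inv_add hQ hA hdet, add_dotProduct, dotProduct_add, dotProduct_add, dotProduct_add, h1,
    mulVec_dotProduct_mulVec_of_transpose_mul_self hQ, dotProduct_comm (A⁻¹ *ᵥ b) b,
    dotProduct_comm (Q *ᵥ u) b]
  have h3 : u ⬝ᵥ (fun i => lam i ^ 2 * u i) = ∑ i, lam i ^ 2 * u i ^ 2 :=
    Finset.sum_congr rfl fun i _ => by ring
  rw [h3]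
  ring

lemma ZSLA_eq_sum (hQ : Qᵀ * Q = 1) (hA : A = Q * diagonal (fun i => lam i ^ 2) * Qᵀ)
    (hdet : IsUnit A.det) (b : Fin d → ℝ) {h : ℝ} (hh : 0 < h) (u v : Fin d → ℝ) :
    ZSLA A b h (A⁻¹ *ᵥ b + Q *ᵥ u) (A⁻¹ *ᵥ b + Q *ᵥ v) =
      ∑ i, h * lam i ^ 4 / 8 * (u i ^ 2 - v i ^ 2) := by
  rw [ZSLA, gaussian_log_density_eq hQ hA hdet, gaussian_log_density_eq hQ hA hdet,
    sub_langevin_eq hQ hA hdet, sub_langevin_eq hQ hA hdet,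
    mulVec_dotProduct_mulVec_of_transpose_mul_self hQ,
    mulVec_dotProduct_mulVec_of_transpose_mul_self hQ]
  simp only [dotProduct]
  rw [← sub_eq_zero]
  calc _ = ∑ i, (-(1 / 2 * (lam i ^ 2 * v i ^ 2)) - 1 / (2 * h) * ((u i - v i +
            h * lam i ^ 2 / 2 * v i) * (u i - v i + h * lam i ^ 2 / 2 * v i)) +
          1 / 2 * (lam i ^ 2 * u i ^ 2) + 1 / (2 * h) * ((v i - u i +
            h * lam i ^ 2 / 2 * u i) * (v i - u i + h * lam i ^ 2 / 2 * u i)) -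
          h * lam i ^ 4 / 8 * (u i ^ 2 - v i ^ 2)) := by
        simp only [Finset.sum_sub_distrib, Finset.sum_add_distrib, Finset.sum_neg_distrib,
          ← Finset.mul_sum]
        ring
    _ = 0 := Finset.sum_eq_zero fun i _ => by field_simp; ring

lemma ZSLA_specState (hQ : Qᵀ * Q = 1) (hA : A = Q * diagonal (fun i => lam i ^ 2) * Qᵀ)
    (hdet : IsUnit A.det) (hpos : ∀ i, 0 < lam i) (b : Fin d → ℝ) {h : ℝ} (hh : 0 < h)
    (ω : (Fin d → ℝ) × (Fin d → ℝ)) :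
    ZSLA A b h (specState A Q b lam ω.1) (specProposal A Q b lam h ω) =
      logRatio (fun i => h * lam i ^ 2) ω := by
  rw [specState, specProposal, ZSLA_eq_sum hQ hA hdet b hh, logRatio]
  refine Finset.sum_congr rfl fun i _ => ?_
  have hl := (hpos i).ne'
  have h1 : √(h * lam i ^ 2) = √h * lam i := by
    rw [Real.sqrt_mul hh.le, Real.sqrt_sq (hpos i).le]
  have h2 : √h ^ 2 = h := Real.sq_sqrt hh.le
  rw [crossCoeff, h1, propCoord]
  generalize √h = r at h2
  subst h2
  field_simp
  ring

lemma dotProduct_specProposal_sub (hpos : ∀ i, 0 < lam i) (b q : Fin d → ℝ) {h : ℝ} (hh : 0 < h)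
    (ω : (Fin d → ℝ) × (Fin d → ℝ)) :
    q ⬝ᵥ (specProposal A Q b lam h ω - specState A Q b lam ω.1) =
      √h * ((Qᵀ *ᵥ q) ⬝ᵥ ω.2 - (fun i => √(h * lam i ^ 2) / 2 * (Qᵀ *ᵥ q) i) ⬝ᵥ ω.1) := by
  rw [specProposal, specState, add_sub_add_left_eq_sub, ← mulVec_sub, dotProduct_mulVec,
    ← mulVec_transpose]
  simp only [dotProduct]
  rw [← Finset.sum_sub_distrib, Finset.mul_sum]
  refine Finset.sum_congr rfl fun i _ => ?_
  have hl := (hpos i).ne'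
  have h1 : √(h * lam i ^ 2) = √h * lam i := by
    rw [Real.sqrt_mul hh.le, Real.sqrt_sq (hpos i).le]
  have h2 : √h ^ 2 = h := Real.sq_sqrt hh.le
  rw [h1, Pi.sub_apply, propCoord]
  generalize √h = r at h2
  subst h2
  field_simp
  ring

end SpectralCoordinates

section Potential

lemma rpow_le_const_mul_rpow {c x a b : ℝ} (hc : 0 < c) (hx : c ≤ x) (hab : a ≤ b) :
    x ^ a ≤ c ^ (a - b) * x ^ b := by
  have hx0 := hc.trans_le hx
  calc x ^ a = x ^ (a - b) * x ^ b := by rw [← Real.rpow_add hx0, sub_add_cancel]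
    _ ≤ _ := mul_le_mul_of_nonneg_right (Real.rpow_le_rpow_of_nonpos hc hx (by linarith))
      (Real.rpow_nonneg hx0.le _)

lemma sq_rpow_div_self {x : ℝ} (hx : 0 < x) (s : ℝ) : (x ^ (2 * s) / x) ^ 2 = x ^ (4 * s - 2) := by
  rw [div_pow, ← Real.rpow_natCast (x ^ (2 * s)), ← Real.rpow_mul hx.le, Real.rpow_sub hx,
    Real.rpow_two]
  congr 2
  push_cast
  ring

section

variable {d : ℕ}

lemma integrable_sum_sq_linear (g α β : Fin d → ℝ) :
    Integrable (fun ω => ∑ i, (g i * (α i * ω.1 i + β i * ω.2 i)) ^ 2) (prodGaussian d) :=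
  integrable_finsetSum _ fun i _ => MemLp.integrable_sq <| MemLp.const_mul
    ((((memLp_eval_stdGaussian i).comp_measurePreserving
      measurePreserving_fst_prodGaussian).const_mul _).add
    (((memLp_eval_stdGaussian i).comp_measurePreserving
      measurePreserving_snd_prodGaussian).const_mul _)) _

lemma integral_sum_sq_linear_le (g α β : Fin d → ℝ) :
    ∫ ω, ∑ i, (g i * (α i * ω.1 i + β i * ω.2 i)) ^ 2 ∂(prodGaussian d) ≤
      2 * ∑ i, g i ^ 2 * (α i ^ 2 + β i ^ 2) := by
  have h1 := integrable_sum_mul_sq fun i => 2 * (g i * α i) ^ 2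
  have h2 := integrable_sum_mul_sq fun i => 2 * (g i * β i) ^ 2
  have h1' : Integrable (fun ω : (Fin d → ℝ) × (Fin d → ℝ) =>
      ∑ i, 2 * (g i * α i) ^ 2 * ω.1 i ^ 2) (prodGaussian d) :=
    measurePreserving_fst_prodGaussian.integrable_comp_of_integrable h1
  have h2' : Integrable (fun ω : (Fin d → ℝ) × (Fin d → ℝ) =>
      ∑ i, 2 * (g i * β i) ^ 2 * ω.2 i ^ 2) (prodGaussian d) :=
    measurePreserving_snd_prodGaussian.integrable_comp_of_integrable h2
  calc _ ≤ ∫ ω : (Fin d → ℝ) × (Fin d → ℝ), (∑ i, 2 * (g i * α i) ^ 2 * ω.1 i ^ 2 +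
          ∑ i, 2 * (g i * β i) ^ 2 * ω.2 i ^ 2) ∂(prodGaussian d) := by
        refine integral_mono (integrable_sum_sq_linear g α β) (h1'.fun_add h2') fun ω => ?_
        simp only
        rw [← Finset.sum_add_distrib]
        refine Finset.sum_le_sum fun i _ => ?_
        nlinarith [sq_nonneg (g i * α i * ω.1 i - g i * β i * ω.2 i)]
    _ = ∑ i, 2 * (g i * α i) ^ 2 + ∑ i, 2 * (g i * β i) ^ 2 := by
        rw [integral_add h1' h2',
          integral_comp_fst_prodGaussian h1.aestronglyMeasurable,
          integral_comp_snd_prodGaussian h2.aestronglyMeasurable, integral_sum_mul_sq,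
          integral_sum_mul_sq]
    _ = _ := by
        rw [← Finset.sum_add_distrib, Finset.mul_sum]
        exact Finset.sum_congr rfl fun i _ => by ring

lemma integral_sum_sq_linear_le_of_le {lam : Fin d → ℝ} {c s r : ℝ} (hc : 0 < c)
    (hlam : ∀ i, c ≤ lam i) (hsr : s ≤ r) {α β : Fin d → ℝ} {a : ℝ}
    (hαβ : ∀ i, α i ^ 2 + β i ^ 2 ≤ a / lam i ^ 2) (ha : 0 ≤ a) :
    ∫ ω, ∑ i, (lam i ^ (2 * s) * (α i * ω.1 i + β i * ω.2 i)) ^ 2 ∂(prodGaussian d) ≤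
      2 * a * c ^ (4 * s - 2 - (4 * r - 1)) * ∑ i, lam i ^ (4 * r - 1) := by
  refine (integral_sum_sq_linear_le _ α β).trans ?_
  rw [Finset.mul_sum, Finset.mul_sum]
  refine Finset.sum_le_sum fun i _ => ?_
  have h0 := hc.trans_le (hlam i)
  calc 2 * ((lam i ^ (2 * s)) ^ 2 * (α i ^ 2 + β i ^ 2)) ≤
        2 * ((lam i ^ (2 * s)) ^ 2 * (a / lam i ^ 2)) := by gcongr; exact hαβ i
    _ = 2 * a * lam i ^ (4 * s - 2) := by rw [← sq_rpow_div_self h0, div_pow]; ring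
    _ ≤ 2 * a * (c ^ (4 * s - 2 - (4 * r - 1)) * lam i ^ (4 * r - 1)) := by
        gcongr
        exact rpow_le_const_mul_rpow hc (hlam i) (by linarith)
    _ = _ := by ring

end

lemma tendsto_integral_min_one_potential_sub {A Q : ∀ d, Matrix (Fin d) (Fin d) ℝ}
    {b lam : ∀ d, Fin d → ℝ} {φ : ∀ d, (Fin d → ℝ) → ℝ} {h Θ : ℕ → ℝ} {c s s' r B : ℝ}
    (hQ : ∀ d, (Q d)ᵀ * Q d = 1) (hc : 0 < c) (hlam : ∀ d i, c ≤ lam d i)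
    (hs : s ≤ r) (hs' : s' ≤ r) (hB : ∀ᶠ d in atTop, ∑ i, lam d i ^ (4 * r - 1) ≤ B)
    (hh : ∀ d, 0 ≤ h d) (hθ : ∀ d i, h d * lam d i ^ 2 ≤ Θ d) (hΘ0 : ∀ d, 0 ≤ Θ d)
    (hΘ : Tendsto Θ atTop (𝓝 0))
    {δ : ℝ → ℝ → ℝ} (hδ : ∀ Rad : ℝ, ∃ K, ∀ a b : ℝ, |a| ≤ Rad → |b| ≤ Rad → δ a b ≤ K)
    (hlip : ∀ᶠ d in atTop, ∀ x y : Fin d → ℝ, |φ d x - φ d y| ≤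
      δ (snorm (Q d) (lam d) s (x - (A d)⁻¹ *ᵥ b d)) (snorm (Q d) (lam d) s (y - (A d)⁻¹ *ᵥ b d)) *
        snorm (Q d) (lam d) s' (x - y)) :
    Tendsto (fun d => ∫ ω, min 1 |φ d (specState (A d) (Q d) (b d) (lam d) ω.1) -
      φ d (specProposal (A d) (Q d) (b d) (lam d) (h d) ω)| ∂(prodGaussian d)) atTop (𝓝 0) := by
  let lin (d : ℕ) (t : ℝ) (α β : Fin d → ℝ) (ω : (Fin d → ℝ) × (Fin d → ℝ)) : ℝ :=
    √(∑ i, (lam d i ^ (2 * t) * (α i * ω.1 i + β i * ω.2 i)) ^ 2)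
  have hlin (d t α β) (ω : (Fin d → ℝ) × (Fin d → ℝ)) : lin d t α β ω ^ 2 =
      ∑ i, (lam d i ^ (2 * t) * (α i * ω.1 i + β i * ω.2 i)) ^ 2 :=
    Real.sq_sqrt (Finset.sum_nonneg fun i _ => sq_nonneg _)
  have hint (d t α β) : Integrable (fun ω => lin d t α β ω ^ 2) (prodGaussian d) := by
    simp only [hlin]
    exact integrable_sum_sq_linear _ α β
  have hlam0 (d i) : 0 < lam d i := hc.trans_le (hlam d i)
  have hsq (d) : √(h d) ^ 2 = h d := Real.sq_sqrt (hh d)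
  have hθ0 (d i) : 0 ≤ h d * lam d i ^ 2 := mul_nonneg (hh d) (sq_nonneg _)
  have hcp (t : ℝ) : 0 ≤ c ^ t := Real.rpow_nonneg hc.le _
  set k : ℝ := c ^ (4 * s - 2 - (4 * r - 1))
  set k' : ℝ := c ^ (4 * s' - 2 - (4 * r - 1))
  refine tendsto_integral_min_one_of_locally_lipschitz
    (S₁ := fun d => lin d s (fun i => 1 / lam d i) 0)
    (S₂ := fun d => lin d s (fun i => (1 - h d * lam d i ^ 2 / 2) / lam d i) fun _ => √(h d))
    (S₃ := fun d => lin d s' (fun i => h d * lam d i ^ 2 / 2 / lam d i) fun _ => -√(h d))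
    (fun d => hint d _ _ _) (fun d => hint d _ _ _) (fun d => hint d _ _ _)
    (fun d ω => Real.sqrt_nonneg _) (fun d ω => Real.sqrt_nonneg _) (fun d ω => Real.sqrt_nonneg _)
    hδ ?_ (B := 2 * 2 * k * B) ?_ ?_ ?_
  · filter_upwards [hlip] with d hlip ω
    refine (hlip _ _).trans_eq ?_
    rw [specState, specProposal, add_sub_cancel_left, add_sub_cancel_left,
      add_sub_add_left_eq_sub, ← mulVec_sub, snorm_mulVec (hQ d), snorm_mulVec (hQ d),
      snorm_mulVec (hQ d)]
    simp only [lin, propCoord, Pi.sub_apply, Pi.zero_apply]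
    congr 4 <;> exact funext fun i => by ring
  · filter_upwards [hB] with d hB
    simp only [hlin]
    refine (integral_sum_sq_linear_le_of_le hc (hlam d) hs (a := 2) (fun i => ?_)
      (by norm_num)).trans (mul_le_mul_of_nonneg_left hB (mul_nonneg (by norm_num) (hcp _)))
    have := hlam0 d i
    rw [div_pow, one_pow, Pi.zero_apply, zero_pow two_ne_zero, add_zero]
    gcongr
    norm_num
  · filter_upwards [hB, hΘ.eventually_le_const one_pos] with d hB hΘ1
    simp only [hlin]
    refine (integral_sum_sq_linear_le_of_le hc (hlam d) hs (a := 2) (fun i => ?_)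
      (by norm_num)).trans (mul_le_mul_of_nonneg_left hB (mul_nonneg (by norm_num) (hcp _)))
    have := hlam0 d i
    rw [le_div_iff₀ (by positivity), add_mul, div_pow, div_mul_cancel₀ _ (by positivity), hsq]
    nlinarith [hθ d i, hθ0 d i]
  · have hlim : Tendsto (fun d => 2 * (2 * Θ d) * k' * B) atTop (𝓝 0) := by
      simpa using ((hΘ.const_mul 2).const_mul 2 |>.mul_const k').mul_const B
    refine squeeze_zero' (.of_forall fun d => integral_nonneg fun ω => sq_nonneg _) ?_ hlim
    filter_upwards [hB, hΘ.eventually_le_const one_pos] with d hB hΘ1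
    simp only [hlin]
    have h2 : 0 ≤ 2 * Θ d := by linarith [hΘ0 d]
    refine (integral_sum_sq_linear_le_of_le hc (hlam d) hs' (a := 2 * Θ d) (fun i => ?_)
      h2).trans (mul_le_mul_of_nonneg_left hB (mul_nonneg (by linarith) (hcp _)))
    have := hlam0 d i
    rw [le_div_iff₀ (by positivity), add_mul, div_pow, div_mul_cancel₀ _ (by positivity), neg_sq,
      hsq]
    nlinarith [hθ d i, hθ0 d i, hΘ0 d]

end Potential

section Assembly

section

variable {d : ℕ} {A Q R : Matrix (Fin d) (Fin d) ℝ} {lam : Fin d → ℝ}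

lemma measurable_mulVec (M : Matrix (Fin d) (Fin d) ℝ) : Measurable fun v : Fin d → ℝ => M *ᵥ v :=
  measurable_pi_lambda _ fun i => measurable_dotProduct (M i)

lemma measurable_specState (b : Fin d → ℝ) : Measurable (specState A Q b lam) :=
  measurable_const.add ((measurable_mulVec Q).comp (by fun_prop))

lemma measurable_specProposal (b : Fin d → ℝ) (h : ℝ) :
    Measurable (specProposal A Q b lam h) := by
  refine measurable_const.add ((measurable_mulVec Q).comp (measurable_pi_lambda _ fun i => ?_))
  unfold propCoord
  fun_prop

lemma measurePreserving_whiten_prod (hQ : Qᵀ * Q = 1) (hpos : ∀ i, 0 < lam i)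
    (hR : R * Rᵀ = (Q * diagonal (fun i => lam i ^ 2) * Qᵀ)⁻¹) :
    MeasurePreserving (fun ω : (Fin d → ℝ) × (Fin d → ℝ) => (whiten Q R lam *ᵥ ω.1, Qᵀ *ᵥ ω.2))
      (prodGaussian d) (prodGaussian d) :=
  (measurePreserving_mulVec_stdGaussian (whiten_mul_transpose hQ hpos hR)).prod
    (measurePreserving_mulVec_stdGaussian (by rwa [transpose_transpose]))

end

lemma integral_comp_of_measurePreserving {α : Type*} [MeasurableSpace α] {μ : Measure α}
    {T : α → α} (hT : MeasurePreserving T μ μ) {f : α → ℝ} (hf : Measurable f) :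
    ∫ x, f (T x) ∂μ = ∫ x, f x ∂μ := by
  conv_rhs => rw [← hT.map_eq]
  rw [integral_map hT.aemeasurable hf.aestronglyMeasurable]

lemma stepSize_mul_sq_le {C κ l x : ℝ} (hC : 0 < C) (hκ : 0 ≤ κ) {d i : ℕ} (hi : i < d)
    (hx0 : 0 ≤ x) (hx : x ≤ C * ((i : ℝ) + 1) ^ κ) :
    l ^ 2 * (d : ℝ) ^ (-(1/3 : ℝ) - 2 * κ) * x ^ 2 ≤ l ^ 2 * C ^ 2 * (d : ℝ) ^ (-(1/3 : ℝ)) := by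
  have hd : (0 : ℝ) < d := by exact_mod_cast (Nat.zero_le i).trans_lt hi
  have hid : (i : ℝ) + 1 ≤ d := by exact_mod_cast hi
  have h1 : x ≤ C * (d : ℝ) ^ κ := hx.trans (by gcongr)
  have h2 : (d : ℝ) ^ (-(1/3 : ℝ) - 2 * κ) * ((d : ℝ) ^ κ) ^ 2 = (d : ℝ) ^ (-(1/3 : ℝ)) := by
    rw [← Real.rpow_natCast ((d : ℝ) ^ κ), ← Real.rpow_mul hd.le, ← Real.rpow_add hd]
    congr 1
    push_cast
    ring
  calc _ ≤ l ^ 2 * (d : ℝ) ^ (-(1/3 : ℝ) - 2 * κ) * (C * (d : ℝ) ^ κ) ^ 2 := by gcongr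
    _ = l ^ 2 * C ^ 2 * ((d : ℝ) ^ (-(1/3 : ℝ) - 2 * κ) * ((d : ℝ) ^ κ) ^ 2) := by ring
    _ = _ := by rw [h2]

lemma sum_stepSize_mul_sq_pow_three {d : ℕ} (κ l : ℝ) (x : Fin d → ℝ) :
    ∑ i, (l ^ 2 * (d : ℝ) ^ (-(1/3 : ℝ) - 2 * κ) * x i ^ 2) ^ 3 =
      l ^ 6 * ((d : ℝ) ^ (-(1 : ℝ) - 6 * κ) * ∑ i, x i ^ 6) := by
  have h : ((d : ℝ) ^ (-(1/3 : ℝ) - 2 * κ)) ^ 3 = (d : ℝ) ^ (-(1 : ℝ) - 6 * κ) := by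
    rw [← Real.rpow_natCast, ← Real.rpow_mul (Nat.cast_nonneg d)]
    congr 1
    push_cast
    ring
  rw [← h, Finset.mul_sum, Finset.mul_sum]
  exact Finset.sum_congr rfl fun i _ => by ring

end Assembly

/-- Theorem: optimal scaling of SLA. Under Assumptions 1 and 2 on
`φ_d`, with eigenvalues satisfying `c iᵏ ≤ λ_i ≤ C iᵏ` and step `h = l²d^{-1/3-2κ}`,
SLA in equilibrium satisfies `E[α(x,y)] → 2Φ(-l³√τ/8)` and
`E[(q_iᵀ(x'-x))²] = 2hΦ(-l³√τ/8) + o(h)` as `d → ∞`, with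
`τ = lim d^{-1-6κ} Σᵢ λ_i⁶`. -/
theorem sla_optimal_scaling
    (A : ∀ d : ℕ, Matrix (Fin d) (Fin d) ℝ)
    (b : ∀ d : ℕ, Fin d → ℝ)
    (Q R : ∀ d : ℕ, Matrix (Fin d) (Fin d) ℝ)
    (lam : ∀ d : ℕ, Fin d → ℝ)
    (φ : ∀ d : ℕ, (Fin d → ℝ) → ℝ)
    (hA : ∀ d, (A d).PosDef)
    (hQ : ∀ d, (Q d)ᵀ * Q d = 1)
    (hdA : ∀ d, ((Q d)ᵀ * A d * Q d).IsDiag)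
    (hlam : ∀ d i, 0 < lam d i ∧ lam d i ^ 2 = ((Q d)ᵀ * A d * Q d) i i)
    (hR : ∀ d, R d * (R d)ᵀ = (A d)⁻¹)
    (hφmeas : ∀ d, Measurable (φ d))
    (hnorm : ∀ d, ∫ ξ, Real.exp (-(φ d (xeq (A d) (b d) (R d) ξ))) ∂stdGaussian d = 1)
    -- spectral growth: c iᵏ ≤ λ_i ≤ C iᵏ
    (c C κ : ℝ) (hc : 0 < c) (hC : 0 < C) (hκ : 0 ≤ κ)
    (hbound : ∀ d (i : Fin d),
      c * ((i : ℕ) + 1 : ℝ) ^ κ ≤ lam d i ∧ lam d i ≤ C * ((i : ℕ) + 1 : ℝ) ^ κ)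
    -- Assumption 1
    (m s s' s'' Cc pp : ℝ) (hCc : 0 < Cc) (hpp : 0 < pp)
    (δfun : ℝ → ℝ → ℝ) (hδnn : ∀ a cc, 0 ≤ δfun a cc)
    (hδloc : ∀ Rad : ℝ, ∃ K, ∀ a cc : ℝ, |a| ≤ Rad → |cc| ≤ Rad → δfun a cc ≤ K)
    (hlower : ∀ᶠ d in atTop, ∀ x : Fin d → ℝ, m ≤ φ d x)
    (hlip : ∀ᶠ d in atTop, ∀ x y : Fin d → ℝ,
      |φ d x - φ d y| ≤
        δfun (snorm (Q d) (lam d) s (x - (A d)⁻¹.mulVec (b d)))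
             (snorm (Q d) (lam d) s (y - (A d)⁻¹.mulVec (b d)))
          * snorm (Q d) (lam d) s' (x - y))
    (hgrow : ∀ᶠ d in atTop, ∀ x : Fin d → ℝ,
      |φ d x| ≤ Cc * (1 + snorm (Q d) (lam d) s'' (x - (A d)⁻¹.mulVec (b d)) ^ pp))
    -- Assumption 2 with r = max{s, s', s''}
    (L2 : ℝ)
    (hA2 : Tendsto (fun d : ℕ => ∑ i, lam d i ^ (4 * max s (max s' s'') - 1))
      atTop (𝓝 L2))
    -- step size h = l² d^{-1/3 - 2κ} and τ = lim d^{-1-6κ} Σ λ_i⁶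
    (l τ : ℝ) (hl : 0 < l)
    (hτ : Tendsto (fun d : ℕ => (d : ℝ) ^ (-(1 : ℝ) - 6 * κ) * ∑ i, lam d i ^ 6)
      atTop (𝓝 τ))
    -- the fixed direction: a normalized eigenvector of A
    (i0 : ℕ) (qv : ∀ d : ℕ, Fin d → ℝ)
    (hqv : ∀ d (hd : i0 < d),
      (A d).mulVec (qv d) = (lam d ⟨i0, hd⟩) ^ 2 • qv d ∧ qv d ⬝ᵥ qv d = 1) :
    Tendsto (fun d : ℕ =>
        ∫ ω, min 1 (Real.exp (φ d (xeq (A d) (b d) (R d) ω.1)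
              - φ d (ySLA (A d) (b d) (l ^ 2 * (d : ℝ) ^ (-(1/3 : ℝ) - 2 * κ))
                  (xeq (A d) (b d) (R d) ω.1) ω.2)
              + ZSLA (A d) (b d) (l ^ 2 * (d : ℝ) ^ (-(1/3 : ℝ) - 2 * κ))
                  (xeq (A d) (b d) (R d) ω.1)
                  (ySLA (A d) (b d) (l ^ 2 * (d : ℝ) ^ (-(1/3 : ℝ) - 2 * κ))
                    (xeq (A d) (b d) (R d) ω.1) ω.2)))
          * Real.exp (-(φ d (xeq (A d) (b d) (R d) ω.1))) ∂prodGaussian d)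
      atTop (𝓝 (2 * Phi (-(l ^ 3) * Real.sqrt τ / 8))) ∧
    (fun d : ℕ =>
        (∫ ω, (qv d ⬝ᵥ (ySLA (A d) (b d) (l ^ 2 * (d : ℝ) ^ (-(1/3 : ℝ) - 2 * κ))
                (xeq (A d) (b d) (R d) ω.1) ω.2 - xeq (A d) (b d) (R d) ω.1)) ^ 2
            * min 1 (Real.exp (φ d (xeq (A d) (b d) (R d) ω.1)
              - φ d (ySLA (A d) (b d) (l ^ 2 * (d : ℝ) ^ (-(1/3 : ℝ) - 2 * κ))
                  (xeq (A d) (b d) (R d) ω.1) ω.2)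
              + ZSLA (A d) (b d) (l ^ 2 * (d : ℝ) ^ (-(1/3 : ℝ) - 2 * κ))
                  (xeq (A d) (b d) (R d) ω.1)
                  (ySLA (A d) (b d) (l ^ 2 * (d : ℝ) ^ (-(1/3 : ℝ) - 2 * κ))
                    (xeq (A d) (b d) (R d) ω.1) ω.2)))
            * Real.exp (-(φ d (xeq (A d) (b d) (R d) ω.1))) ∂prodGaussian d)
          - 2 * (l ^ 2 * (d : ℝ) ^ (-(1/3 : ℝ) - 2 * κ))
              * Phi (-(l ^ 3) * Real.sqrt τ / 8))
      =o[atTop] (fun d : ℕ => l ^ 2 * (d : ℝ) ^ (-(1/3 : ℝ) - 2 * κ)) := by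
  set h : ℕ → ℝ := fun d => l ^ 2 * (d : ℝ) ^ (-(1/3 : ℝ) - 2 * κ) with hh
  have hh0 (d : ℕ) : 0 ≤ h d := by positivity
  have hhpos : ∀ᶠ d in atTop, 0 < h d := by
    filter_upwards [eventually_gt_atTop 0] with d hd
    have : (0 : ℝ) < d := Nat.cast_pos.2 hd
    positivity
  have hpos (d) (i : Fin d) : 0 < lam d i := (hlam d i).1
  have hlamc (d) (i : Fin d) : c ≤ lam d i := by
    have h1 : (1 : ℝ) ≤ ((i : ℕ) + 1 : ℝ) ^ κ := Real.one_le_rpow (by simp) hκ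
    exact (le_mul_of_one_le_right hc.le h1).trans (hbound d i).1
  have hAeq (d) := eq_conj_diagonal (hQ d) (hdA d) fun i => (hlam d i).2
  have hdet (d) : IsUnit (A d).det := (hA d).det_pos.ne'.isUnit
  have hRR (d) : R d * (R d)ᵀ = (Q d * diagonal (fun i => lam d i ^ 2) * (Q d)ᵀ)⁻¹ := by
    rw [← hAeq, hR]
  set θ : ∀ d, Fin d → ℝ := fun d i => h d * lam d i ^ 2 with hθdef
  set Θ : ℕ → ℝ := fun d => l ^ 2 * C ^ 2 * (d : ℝ) ^ (-(1/3 : ℝ))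
  have hθ0 (d) (i : Fin d) : 0 ≤ θ d i := mul_nonneg (hh0 d) (sq_nonneg _)
  have hθ (d) (i : Fin d) : θ d i ≤ Θ d :=
    stepSize_mul_sq_le hC hκ i.2 (hpos d i).le (hbound d i).2
  have hΘ0 (d) : 0 ≤ Θ d := by positivity
  have hΘ : Tendsto Θ atTop (𝓝 0) := by
    have hrpow := ((tendsto_rpow_neg_atTop (by norm_num : (0 : ℝ) < 1 / 3)).comp
      tendsto_natCast_atTop_atTop).const_mul (l ^ 2 * C ^ 2)
    rw [mul_zero] at hrpow
    exact hrpow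
  have hS : Tendsto (fun d => ∑ i, θ d i ^ 3) atTop (𝓝 (l ^ 6 * τ)) := by
    simp only [hθdef, hh, sum_stepSize_mul_sq_pow_three]
    exact hτ.const_mul _
  set ρ : ∀ d, (Fin d → ℝ) → ℝ := fun d ζ =>
    Real.exp (-φ d (specState (A d) (Q d) (b d) (lam d) ζ)) with hρdef
  set F : ∀ d, (Fin d → ℝ) × (Fin d → ℝ) → ℝ := fun d ω =>
    φ d (specState (A d) (Q d) (b d) (lam d) ω.1) -
      φ d (specProposal (A d) (Q d) (b d) (lam d) (h d) ω)
  have hρ (d) : Measurable (ρ d) :=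
    ((hφmeas d).comp (measurable_specState (b d))).neg.exp
  have hF (d) : Measurable (F d) :=
    (((hφmeas d).comp (measurable_specState (b d))).comp measurable_fst).sub
      ((hφmeas d).comp (measurable_specProposal (b d) (h d)))
  have hρK : ∀ᶠ d in atTop, ∀ ζ, ρ d ζ ≤ Real.exp (-m) := by
    filter_upwards [hlower] with d hd ζ
    exact Real.exp_le_exp.2 (neg_le_neg (hd _))
  have hρ1 (d) : ∫ ζ, ρ d ζ ∂(_root_.stdGaussian d) = 1 := by
    rw [← hnorm d, ← integral_comp_of_measurePreserving
      (measurePreserving_mulVec_stdGaussian (whiten_mul_transpose (hQ d) (hpos d) (hRR d))) (hρ d)]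
    simp only [hρdef, xeq_eq_specState (hQ d) (hpos d)]
  have hF0 : Tendsto (fun d => ∫ ω, min 1 |F d ω| ∂(prodGaussian d)) atTop (𝓝 0) :=
    tendsto_integral_min_one_potential_sub hQ hc hlamc (le_max_left s (max s' s''))
      ((le_max_left s' s'').trans (le_max_right s _))
      (hA2.eventually_le_const (lt_add_one L2)) hh0 hθ hΘ0 hΘ hδloc hlip
  set p : ∀ d, Fin d → ℝ := fun d => (Q d)ᵀ *ᵥ qv d with hpdef
  have hp : ∀ᶠ d in atTop, p d ⬝ᵥ p d = 1 := by
    filter_upwards [eventually_gt_atTop i0] with d hd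
    rw [hpdef, mulVec_dotProduct_mulVec_of_transpose_mul_self, (hqv d hd).2]
    rw [transpose_transpose]
    exact mul_eq_one_comm.1 (hQ d)
  have hlimit : -(√(l ^ 6 * τ) / 4) / 2 = -(l ^ 3) * √τ / 8 := by
    rw [Real.sqrt_mul (by positivity), show l ^ 6 = (l ^ 3) ^ 2 by ring,
      Real.sqrt_sq (by positivity)]
    ring
  set T : ∀ d, (Fin d → ℝ) × (Fin d → ℝ) → (Fin d → ℝ) × (Fin d → ℝ) := fun d ω =>
    (whiten (Q d) (R d) (lam d) *ᵥ ω.1, (Q d)ᵀ *ᵥ ω.2)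
  have hT (d) := measurePreserving_whiten_prod (hQ d) (hpos d) (hRR d)
  have hx (d) (ω : (Fin d → ℝ) × (Fin d → ℝ)) : xeq (A d) (b d) (R d) ω.1 =
      specState (A d) (Q d) (b d) (lam d) (T d ω).1 := xeq_eq_specState (hQ d) (hpos d) _ _
  have hy (d) (ω : (Fin d → ℝ) × (Fin d → ℝ)) :
      ySLA (A d) (b d) (h d) (specState (A d) (Q d) (b d) (lam d) (T d ω).1) ω.2 =
      specProposal (A d) (Q d) (b d) (lam d) (h d) (T d ω) :=
    ySLA_specState (hQ d) (hAeq d) (hdet d) _ _ _ _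
  have hz (d) (hd : 0 < h d) (ω : (Fin d → ℝ) × (Fin d → ℝ)) :
      ZSLA (A d) (b d) (h d) (specState (A d) (Q d) (b d) (lam d) ω.1)
        (specProposal (A d) (Q d) (b d) (lam d) (h d) ω) = logRatio (θ d) ω :=
    ZSLA_specState (hQ d) (hAeq d) (hdet d) (hpos d) _ hd _
  have haccm (d) : Measurable fun ω => acc (F d ω + logRatio (θ d) ω) :=
    measurable_acc.comp ((hF d).add (measurable_logRatio _))
  rw [← hlimit]
  constructor
  · refine (tendsto_integral_acc hθ0 hθ hΘ hS hp hρ (fun d ζ => (Real.exp_pos _).le) hρK hρ1 hF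
      hF0).congr' ?_
    filter_upwards [hhpos] with d hd
    have hmeas : Measurable fun ω : (Fin d → ℝ) × (Fin d → ℝ) =>
        acc (F d ω + logRatio (θ d) ω) * ρ d ω.1 := (haccm d).mul ((hρ d).comp measurable_fst)
    rw [← integral_comp_of_measurePreserving (hT d) hmeas]
    refine integral_congr_ae (.of_forall fun ω => ?_)
    simp only
    rw [hx d ω, hy d ω, hz d hd]
    rfl
  · have hlim := tendsto_integral_sq_jump_mul_acc hθ0 hθ hΘ hS hp hρ
      (fun d ζ => (Real.exp_pos _).le) hρK hρ1 hF hF0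
    have hlim0 := (isLittleO_one_iff ℝ).2 (tendsto_sub_nhds_zero_iff.2 hlim)
    have hmul := (isBigO_refl h atTop).mul_isLittleO hlim0
    simp only [mul_one] at hmul
    refine hmul.congr' ?_ .rfl
    filter_upwards [hhpos] with d hd
    have hjump : Measurable fun ω : (Fin d → ℝ) × (Fin d → ℝ) =>
        (p d ⬝ᵥ ω.2 - (fun i => √(θ d i) / 2 * p d i) ⬝ᵥ ω.1) ^ 2 :=
      (((measurable_dotProduct _).comp measurable_snd).sub
        ((measurable_dotProduct _).comp measurable_fst)).pow_const 2
    have hmeas : Measurable fun ω : (Fin d → ℝ) × (Fin d → ℝ) =>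
        (p d ⬝ᵥ ω.2 - (fun i => √(θ d i) / 2 * p d i) ⬝ᵥ ω.1) ^ 2 *
          acc (F d ω + logRatio (θ d) ω) * ρ d ω.1 :=
      (hjump.mul (haccm d)).mul ((hρ d).comp measurable_fst)
    rw [← integral_comp_of_measurePreserving (hT d) hmeas, mul_sub, ← integral_const_mul]
    congr 1
    · refine integral_congr_ae (.of_forall fun ω => ?_)
      simp only
      rw [hx d ω, hy d ω, hz d hd, dotProduct_specProposal_sub (hpos d) _ _ hd, mul_pow,
        Real.sq_sqrt hd.le, mul_assoc (h d), mul_assoc (h d)]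
      rfl
    · ring
end

section
/- Let A, V ∈ ℝ^{d×d} be symmetric positive definite, θ ∈ [0,1], h > 0, and b ∈ ℝ^d; set B = V^{1/2} A V^{1/2}, W = I + (θ − ½)(h/2)B, W̃ = I + (θ − ½)(h/2)AV, and assume I + (θh/2)B and W are invertible. Define M = (2/h) V^{-1/2} W (I + (θh/2)B) V^{-1/2}, N = (2/h) V^{-1/2} W (I − ((1−θ)h/2)B) V^{-1/2}, and β = W̃ b. Then M − N = W̃ A, M^{-1}N = (I + (θh/2)VA)^{-1}(I − ((1−θ)h/2)VA), M^{-1}β = (h/2)(I + (θh/2)VA)^{-1} V b, and M^{-1}(M^T + N)M^{-T} = (I + (θh/2)VA)^{-1} (hV) (I + (θh/2)AV)^{-1}; that is, the generalized Langevin proposal y = (I + (θh/2)VA)^{-1}[(I − ((1−θ)h/2)VA)x + (h/2)Vb + (hV)^{1/2}ξ], ξ ~ N(0, I), corresponds to this matrix splitting. -/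
open Matrix

/-- Theorem: matrix splitting for the generalized Langevin proposal.
With `B = V^{1/2} A V^{1/2}`, `W = I + (θ-½)(h/2)B`, `W̃ = I + (θ-½)(h/2)AV`, the matrices
`M = (2/h)V^{-1/2}W(I + (θh/2)B)V^{-1/2}`, `N = (2/h)V^{-1/2}W(I - ((1-θ)h/2)B)V^{-1/2}`,
`β = W̃ b` give the splitting of the generalized Langevin proposal
`y = (I + (θh/2)VA)⁻¹[(I - ((1-θ)h/2)VA)x + (h/2)Vb + (hV)^{1/2}ξ]`. -/
theorem general_langevin_matrix_splitting {d : ℕ}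
    (A V Vh : Matrix (Fin d) (Fin d) ℝ) (b : Fin d → ℝ) (θ h : ℝ)
    (hA : A.PosDef) (hV : V.PosDef) (hVh : Vh.PosDef) (hVhsq : Vh * Vh = V)
    (hθ : θ ∈ Set.Icc (0 : ℝ) 1) (hh : 0 < h)
    (hP : IsUnit (1 + (θ * h / 2) • (Vh * A * Vh)))
    (hW : IsUnit (1 + ((θ - 1 / 2) * (h / 2)) • (Vh * A * Vh))) :
    -- abbreviations
    (let B := Vh * A * Vh
     let W := 1 + ((θ - 1 / 2) * (h / 2)) • B
     let Wt := 1 + ((θ - 1 / 2) * (h / 2)) • (A * V)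
     let M := (2 / h) • (Vh⁻¹ * W * (1 + (θ * h / 2) • B) * Vh⁻¹)
     let N := (2 / h) • (Vh⁻¹ * W * (1 - ((1 - θ) * h / 2) • B) * Vh⁻¹)
     let β := Wt.mulVec b
     M - N = Wt * A ∧
     M⁻¹ * N = (1 + (θ * h / 2) • (V * A))⁻¹ * (1 - ((1 - θ) * h / 2) • (V * A)) ∧
     M⁻¹.mulVec β = (h / 2) • ((1 + (θ * h / 2) • (V * A))⁻¹.mulVec (V.mulVec b)) ∧
     M⁻¹ * (Mᵀ + N) * (M⁻¹)ᵀ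
        = (1 + (θ * h / 2) • (V * A))⁻¹ * (h • V) * (1 + (θ * h / 2) • (A * V))⁻¹) := by
  intro B W Wt M N β
  set P : Matrix (Fin d) (Fin d) ℝ := 1 + (θ * h / 2) • B with hPdef
  set Q : Matrix (Fin d) (Fin d) ℝ := 1 - ((1 - θ) * h / 2) • B with hQdef
  have hM : M = (2 / h) • (Vh⁻¹ * W * P * Vh⁻¹) := rfl
  have hN : N = (2 / h) • (Vh⁻¹ * W * Q * Vh⁻¹) := rfl
  have hscal : h / 2 * (2 / h) = 1 := by field_simp
  have hscal' : 2 / h * (h / 2) = 1 := by field_simp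
  have hVu : IsUnit Vh.det := (isUnit_iff_isUnit_det _).1 hVh.isUnit
  have hPu : IsUnit P.det := (isUnit_iff_isUnit_det _).1 hP
  have hWu : IsUnit W.det := (isUnit_iff_isUnit_det _).1 hW
  have hVt : Vhᵀ = Vh := by simpa using hVh.isHermitian.eq
  have hAt : Aᵀ = A := by simpa using hA.isHermitian.eq
  have hBt : Bᵀ = B := by simp [B, hVt, hAt, Matrix.mul_assoc]
  have hPt : Pᵀ = P := by simp [hPdef, hBt]
  have hWt : Wᵀ = W := by simp [W, hBt]
  have hPW : P * W = W * P := by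
    simp only [hPdef, W]
    exact (((Commute.one_right _).add_right (((Commute.one_left B).add_left
      ((Commute.refl B).smul_left _)).smul_right _))).eq
  have hWtVh : Vh * Wt = W * Vh := by
    simp [Wt, W, B, ← hVhsq, mul_add, add_mul, Matrix.mul_assoc]
  have hMinv : M⁻¹ = (h / 2) • (Vh * P⁻¹ * W⁻¹ * Vh) := by
    apply inv_eq_right_inv
    simp only [hM, Matrix.smul_mul, Matrix.mul_smul, smul_smul, Matrix.mul_assoc,
      nonsing_inv_mul_cancel_left _ _ hVu, mul_nonsing_inv_cancel_left _ _ hPu,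
      mul_nonsing_inv_cancel_left _ _ hWu, nonsing_inv_mul _ hVu]
    rw [hscal, one_smul]
  have hMt : Mᵀ = M := by
    simp only [hM, transpose_smul, transpose_mul, transpose_nonsing_inv, hVt, hPt, hWt]
    simp only [← Matrix.mul_assoc]
    rw [Matrix.mul_assoc Vh⁻¹ P W, hPW, ← Matrix.mul_assoc]
  have hVA : (1 + (θ * h / 2) • (V * A))⁻¹ = Vh * P⁻¹ * Vh⁻¹ := by
    have key : 1 + (θ * h / 2) • (V * A) = Vh * P * Vh⁻¹ := by
      simp [hPdef, B, ← hVhsq, mul_add, add_mul, Matrix.mul_assoc, mul_nonsing_inv _ hVu]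
    apply inv_eq_right_inv
    simp only [key, Matrix.mul_assoc, nonsing_inv_mul_cancel_left _ _ hVu,
      mul_nonsing_inv_cancel_left _ _ hPu, mul_nonsing_inv _ hVu]
  have hQVA : 1 - ((1 - θ) * h / 2) • (V * A) = Vh * Q * Vh⁻¹ := by
    simp [hQdef, B, ← hVhsq, mul_sub, sub_mul, Matrix.mul_assoc, mul_nonsing_inv _ hVu]
  have hAV : (1 + (θ * h / 2) • (A * V))⁻¹ = Vh⁻¹ * P⁻¹ * Vh := by
    have key : 1 + (θ * h / 2) • (A * V) = (1 + (θ * h / 2) • (V * A))ᵀ := by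
      simp [← hVhsq, hVt, hAt]
    rw [key, ← transpose_nonsing_inv, hVA]
    simp [transpose_nonsing_inv, hVt, hPt, Matrix.mul_assoc]
  have hPQ : P - Q = (h / 2) • B := by
    simp only [hPdef, hQdef]
    module
  have hPQW : P + Q = (2 : ℝ) • W := by
    simp only [hPdef, hQdef, W]
    module
  refine ⟨?_, ?_, ?_, ?_⟩
  · have : M - N = (2 / h) • (Vh⁻¹ * W * (P - Q) * Vh⁻¹) := by
      simp only [hM, hN, mul_sub, sub_mul, smul_sub]
    rw [this, hPQ]
    simp only [Matrix.smul_mul, Matrix.mul_smul, smul_smul]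
    rw [hscal', one_smul]
    have hB : B * Vh⁻¹ = Vh * A := by
      simp only [B, Matrix.mul_assoc, mul_nonsing_inv _ hVu, Matrix.mul_one]
    rw [Matrix.mul_assoc, hB, ← Matrix.mul_assoc, Matrix.mul_assoc Vh⁻¹, ← hWtVh,
      nonsing_inv_mul_cancel_left _ _ hVu]
  · rw [hMinv, hVA, hQVA]
    simp only [hN, Matrix.smul_mul, Matrix.mul_smul, smul_smul, Matrix.mul_assoc,
      nonsing_inv_mul_cancel_left _ _ hVu, mul_nonsing_inv_cancel_left _ _ hVu,
      nonsing_inv_mul_cancel_left _ _ hWu]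
    rw [hscal', one_smul]
  · rw [hMinv, hVA, mulVec_mulVec, mulVec_mulVec, ← smul_mulVec]
    congr 1
    simp only [← hVhsq, Matrix.smul_mul, Matrix.mul_assoc, hWtVh,
      nonsing_inv_mul_cancel_left _ _ hVu, nonsing_inv_mul_cancel_left _ _ hWu]
  · have hMN : Mᵀ + N = (4 / h) • (Vh⁻¹ * W * W * Vh⁻¹) := by
      have : M + N = (2 / h) • (Vh⁻¹ * W * (P + Q) * Vh⁻¹) := by
        simp only [hM, hN, mul_add, add_mul, smul_add]
      rw [hMt, this, hPQW]
      simp only [Matrix.smul_mul, Matrix.mul_smul, smul_smul]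
      congr 1
      ring
    have hMinvt : (M⁻¹)ᵀ = (h / 2) • (Vh * W⁻¹ * P⁻¹ * Vh) := by
      rw [hMinv]
      simp [transpose_nonsing_inv, hVt, hPt, hWt, Matrix.mul_assoc]
    rw [hMN, hMinvt, hMinv, hVA, hAV, ← hVhsq]
    simp only [Matrix.smul_mul, Matrix.mul_smul, smul_smul, Matrix.mul_assoc,
      nonsing_inv_mul_cancel_left _ _ hVu, mul_nonsing_inv_cancel_left _ _ hVu,
      nonsing_inv_mul_cancel_left _ _ hWu, mul_nonsing_inv_cancel_left _ _ hWu]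
    congr 1
    field_simp
    norm_num
end
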